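/- For every function μ : [2,∞) → (0,∞) with μ(t) → ∞ as t → ∞, the set of complex numbers a for which the set {s ∈ ℂ : Im(s) ≥ 2, |Re(s) − 1/2| < μ(Im s)/log(Im s), and ζ(s) = a} is finite has at most one element. -/

import Mathlib

open Complex Filter Set Topology

namespace Stmt6

open Metric in
lemma exists_log_ball {f : ℂ → ℂ} {c w : ℂ} {r : ℝ} (hr : 0 < r)
    (hf : DifferentiableOn ℂ f (ball c r)) (h0 : ∀ z ∈ ball c r, f z ≠ 0)
    (hw : cexp w = f c) :
    ∃ g : ℂ → ℂ, DifferentiableOn ℂ g (ball c r) ∧ (∀ z ∈ ball c r, cexp (g z) = f z) ∧ g c = w := by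
  have hd : DifferentiableOn ℂ (fun z => deriv f z / f z) (ball c r) :=
    (hf.deriv isOpen_ball).div hf h0
  obtain ⟨g, hgc, hg⟩ := hd.isExactOn_ball.with_val_at c w
  have hcr : c ∈ ball c r := mem_ball_self hr
  refine ⟨g, fun z hz => (hg z hz).differentiableAt.differentiableWithinAt, ?_, hgc⟩
  have hder : ∀ z ∈ ball c r, HasDerivAt (fun z => f z * cexp (-g z)) 0 z := by
    intro z hz
    have h1 : HasDerivAt f (deriv f z) z :=
      (hf.differentiableAt (isOpen_ball.mem_nhds hz)).hasDerivAt
    have h2 := h1.mul ((hg z hz).neg.cexp)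
    refine h2.congr_deriv ?_
    have := h0 z hz
    simp only [Pi.neg_apply]
    field_simp
    ring
  intro z hz
  have hconst := isOpen_ball.is_const_of_deriv_eq_zero (convex_ball c r).isPreconnected
    (fun z hz => (hder z hz).differentiableAt.differentiableWithinAt)
    (fun z hz => (hder z hz).deriv) hz hcr
  simp only [hgc, exp_neg, ← hw] at hconst
  rw [mul_inv_cancel₀ (exp_ne_zero w)] at hconst
  field_simp at hconst
  exact hconst.symm

open Metric in
lemma bloch_local {g : ℂ → ℂ} {a : ℂ} {ρ : ℝ} (hρ : 0 < ρ)
    (hg : DifferentiableOn ℂ g (ball a ρ)) (hm : 0 < ‖deriv g a‖)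
    (hb : ∀ z ∈ ball a ρ, ‖deriv g z‖ ≤ 2 * ‖deriv g a‖) :
    ball (g a) (‖deriv g a‖ * ρ / 32) ⊆ g '' ball a ρ := by
  set m := ‖deriv g a‖ with hmdef
  have hd := hg.deriv isOpen_ball
  have hmaps : MapsTo (deriv g) (ball a ρ) (ball (deriv g a) (4 * m)) := by
    intro z hz
    rw [mem_ball, dist_eq_norm]
    have := norm_sub_le (deriv g z) (deriv g a)
    have := hb z hz
    linarith
  have hsub : closedBall a (ρ / 8) ⊆ ball a ρ := closedBall_subset_ball (by linarith)
  have hd8 : ∀ z ∈ closedBall a (ρ / 8), ‖deriv g z - deriv g a‖ ≤ m / 2 := by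
    intro z hz
    have h := dist_le_div_mul_dist_of_mapsTo_ball hd
      (hmaps.mono_right ball_subset_closedBall) (hsub hz)
    rw [dist_eq_norm] at h
    have hz' : dist z a ≤ ρ / 8 := hz
    calc _ ≤ 4 * m / ρ * dist z a := h
      _ ≤ 4 * m / ρ * (ρ / 8) := by gcongr
      _ = m / 2 := by field_simp; norm_num
  have hlow : ∀ z ∈ sphere a (ρ / 8), m * ρ / 16 ≤ ‖g z - g a‖ := by
    intro z hz
    have hder : ∀ x ∈ closedBall a (ρ / 8),
        HasDerivWithinAt (fun z => g z - deriv g a * z) (deriv g x - deriv g a) (closedBall a (ρ / 8)) x := by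
      intro x hx
      have h1 : HasDerivAt g (deriv g x) x :=
        (hg.differentiableAt (isOpen_ball.mem_nhds (hsub hx))).hasDerivAt
      have h2 : HasDerivAt (fun z => deriv g a * z) (deriv g a) x := by
        simpa using (hasDerivAt_id x).const_mul (deriv g a)
      exact (h1.sub h2).hasDerivWithinAt
    have h := (convex_closedBall a (ρ / 8)).norm_image_sub_le_of_norm_hasDerivWithin_le hder hd8
      (mem_closedBall_self (by positivity)) (sphere_subset_closedBall hz)
    have hz' : ‖z - a‖ = ρ / 8 := by rw [← dist_eq_norm]; exact hz
    rw [hz'] at h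
    have e : deriv g a * (z - a) = (g z - g a) - (g z - deriv g a * z - (g a - deriv g a * a)) := by ring
    have h3 : m * (ρ / 8) ≤ ‖g z - g a‖ + ‖g z - deriv g a * z - (g a - deriv g a * a)‖ := by
      rw [← hz', hmdef, ← norm_mul, e]
      exact norm_sub_le _ _
    linarith
  have hfreq : ∃ᶠ z in 𝓝 a, g z ≠ g a := by
    have h1 : HasDerivAt g (deriv g a) a :=
        (hg.differentiableAt (isOpen_ball.mem_nhds (mem_ball_self hρ))).hasDerivAt
    have h2 := h1.eventually_ne (c := g a) (by rintro h; rw [hmdef, h] at hm; simp at hm)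
    exact h2.frequently.filter_mono nhdsWithin_le_nhds
  have hdc : DiffContOnCl ℂ g (ball a (ρ / 8)) := by
    apply DifferentiableOn.diffContOnCl
    exact hg.mono ((closure_ball_subset_closedBall).trans hsub)
  have := hdc.ball_subset_image_closedBall (by positivity) hlow hfreq
  rw [show m * ρ / 32 = m * ρ / 16 / 2 by ring]
  exact this.trans (image_mono hsub)

open Metric in
lemma bloch {g : ℂ → ℂ} {c : ℂ} {R β : ℝ} (hR : 0 < R)
    (hg : DifferentiableOn ℂ g (ball c R))
    (hno : ∀ w, ¬ (ball w β ⊆ g '' ball c R)) : ‖deriv g c‖ * R ≤ 128 * β := by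
  have hsub : closedBall c (R / 2) ⊆ ball c R := closedBall_subset_ball (by linarith)
  have hd := hg.deriv isOpen_ball
  have hcont : ContinuousOn (fun z => ‖deriv g z‖ * (R / 2 - dist z c)) (closedBall c (R / 2)) := by
    refine ((hd.continuousOn.mono hsub).norm).mul (by fun_prop)
  obtain ⟨a, ha, hmax⟩ := (isCompact_closedBall c (R / 2)).exists_isMaxOn
    ⟨c, mem_closedBall_self (by positivity)⟩ hcont
  have hmax' : ∀ z ∈ closedBall c (R / 2), ‖deriv g z‖ * (R / 2 - dist z c) ≤
    ‖deriv g a‖ * (R / 2 - dist a c) := fun z hz => hmax hz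
  have hc := hmax' c (mem_closedBall_self (by positivity))
  rw [dist_self, sub_zero] at hc
  have hβ : 0 < β := by
    by_contra h
    exact hno 0 (by rw [ball_eq_empty.mpr (not_lt.mp h)]; exact empty_subset _)
  by_contra hcon
  push Not at hcon
  have hpos : 0 < ‖deriv g a‖ * (R / 2 - dist a c) := by linarith
  have hac : dist a c ≤ R / 2 := ha
  have h1 : 0 < R / 2 - dist a c := by
    rcases (sub_nonneg.mpr hac).eq_or_lt with h | h
    · rw [← h] at hpos; simp at hpos
    · exact h
  have h2 : 0 < ‖deriv g a‖ := pos_of_mul_pos_left hpos h1.le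
  set ρ := (R / 2 - dist a c) / 2 with hρ
  have hbsub : ball a ρ ⊆ closedBall c (R / 2) := by
    intro z hz
    have hz' : dist z a < ρ := hz
    have := dist_triangle z a c
    rw [mem_closedBall]; linarith
  have := bloch_local (a := a) (ρ := ρ) (by positivity) (hg.mono (hbsub.trans hsub)) h2 (by
    intro z hz
    have hz' : dist z a < ρ := hz
    have h3 := hmax' z (hbsub hz)
    have h4 := dist_triangle z a c
    have h5 : ρ ≤ R / 2 - dist z c := by linarith
    have h6 : ‖deriv g z‖ * ρ ≤ ‖deriv g z‖ * (R / 2 - dist z c) := by gcongr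
    have h7 : ‖deriv g z‖ * ρ ≤ 2 * ‖deriv g a‖ * ρ := by
      calc _ ≤ _ := h6.trans h3
        _ = _ := by rw [hρ]; ring
    exact le_of_mul_le_mul_right h7 (by positivity))
  refine hno (g a) ((ball_subset_ball ?_).trans (this.trans (image_mono (hbsub.trans hsub))))
  rw [hρ]; linarith


/-- The omitted lattice is relatively dense. -/
lemma lattice_dense (w : ℂ) : ∃ (n : ℕ) (k : ℤ) (e : ℝ), 1 ≤ n ∧ (e = 1 ∨ e = -1) ∧
    ((e * Real.log (√n + √(n - 1 : ℝ)) : ℝ) + (k * Real.pi : ℝ) * I : ℂ) ∈ Metric.ball w 3 := by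
  set x := |w.re| with hx
  have hx0 : 0 ≤ x := abs_nonneg _
  set n := ⌈Real.exp (2 * x) / 4⌉₊ with hn
  have hn1 : 1 ≤ n := Nat.one_le_iff_ne_zero.mpr (by
    rw [hn]; exact (Nat.ceil_pos.mpr (by positivity)).ne')
  have hn1' : (1 : ℝ) ≤ n := by exact_mod_cast hn1
  have hlo : Real.exp (2 * x) / 4 ≤ n := Nat.le_ceil _
  have hhi : (n : ℝ) < Real.exp (2 * x) / 4 + 1 := Nat.ceil_lt_add_one (by positivity)
  have hexp : Real.exp (2 * x) = Real.exp x ^ 2 := by rw [← Real.exp_nat_mul]; norm_num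
  have hex1 : 1 ≤ Real.exp x := Real.one_le_exp hx0
  have he : (2.7 : ℝ) < Real.exp 1 := by have := Real.exp_one_gt_d9; linarith
  set q := √(n : ℝ) + √(n - 1 : ℝ) with hq
  have hq1 : Real.exp x / 2 ≤ q := by
    have : Real.exp x / 2 ≤ √(n : ℝ) := Real.le_sqrt_of_sq_le (by rw [div_pow, ← hexp]; linarith)
    have := Real.sqrt_nonneg (n - 1 : ℝ)
    linarith
  have hq2 : q ≤ Real.exp x * 2.5 := by
    have h1 : √(n : ℝ) ≤ Real.exp x * 1.25 :=
      Real.sqrt_le_iff.mpr ⟨by positivity, by rw [hexp] at hhi; nlinarith⟩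
    have h2 : √(n - 1 : ℝ) ≤ √(n : ℝ) := Real.sqrt_le_sqrt (by linarith)
    linarith
  have hqpos : 0 < q := lt_of_lt_of_le (by positivity) hq1
  have hl1 : Real.log q ≤ x + 1 := by
    rw [Real.log_le_iff_le_exp hqpos, Real.exp_add]
    nlinarith
  have hl2 : x - 1 ≤ Real.log q := by
    rw [Real.le_log_iff_exp_le hqpos, Real.exp_sub, div_le_iff₀ (by positivity)]
    nlinarith
  refine ⟨n, round (w.im / Real.pi), if 0 ≤ w.re then 1 else -1, hn1, by split_ifs <;> simp, ?_⟩
  rw [Metric.mem_ball, dist_eq_norm]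
  have hre : |(if 0 ≤ w.re then (1:ℝ) else -1) * Real.log q - w.re| ≤ 1 := by
    split_ifs with h
    · rw [abs_of_nonneg h] at hx
      rw [abs_le]; constructor <;> linarith
    · rw [abs_of_neg (not_le.mp h)] at hx
      rw [abs_le]; constructor <;> linarith
  have him : |round (w.im / Real.pi) * Real.pi - w.im| ≤ Real.pi / 2 := by
    have h1 := abs_sub_round (w.im / Real.pi)
    have h2 : round (w.im / Real.pi) * Real.pi - w.im =
      -((w.im / Real.pi - round (w.im / Real.pi)) * Real.pi) := by
      field_simp; ring
    rw [h2, abs_neg, abs_mul, abs_of_pos Real.pi_pos]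
    have := Real.pi_pos
    nlinarith
  refine lt_of_le_of_lt (Complex.norm_le_abs_re_add_abs_im _) ?_
  have h1 : ((((if 0 ≤ w.re then (1:ℝ) else -1) * Real.log q : ℝ) : ℂ) +
    ((round (w.im / Real.pi) * Real.pi : ℝ) : ℂ) * I - w).re =
    (if 0 ≤ w.re then (1:ℝ) else -1) * Real.log q - w.re := by
    simp only [sub_re, add_re, ofReal_re, mul_re, I_re, I_im, ofReal_im]; ring
  have h2 : ((((if 0 ≤ w.re then (1:ℝ) else -1) * Real.log q : ℝ) : ℂ) +
    ((round (w.im / Real.pi) * Real.pi : ℝ) : ℂ) * I - w).im =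
    round (w.im / Real.pi) * Real.pi - w.im := by
    simp only [sub_im, add_im, ofReal_re, mul_im, I_re, I_im, ofReal_im]; ring
  rw [h1, h2]
  have := Real.pi_lt_d2
  linarith

lemma norm_log_le {z : ℂ} {K : ℝ} (hK : 0 < K) (h1 : ‖z‖ ≤ K) (h2 : K⁻¹ ≤ ‖z‖) :
    ‖Complex.log z‖ ≤ Real.log K + Real.pi := by
  refine (Complex.norm_le_abs_re_add_abs_im _).trans ?_
  rw [log_re, log_im]
  have hz : 0 < ‖z‖ := lt_of_lt_of_le (by positivity) h2
  gcongr
  · rw [abs_le]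
    constructor
    · rw [← Real.log_inv]; exact Real.log_le_log (by positivity) h2
    · exact Real.log_le_log hz h1
  · exact abs_arg_le_pi z

lemma lattice_value {n : ℕ} (hn : 1 ≤ n) (k : ℤ) {e : ℝ} (he : e = 1 ∨ e = -1) {g A B : ℂ}
    (hg : g = ((e * Real.log (√n + √(n - 1 : ℝ)) : ℝ) + (k * Real.pi : ℝ) * I : ℂ))
    (hAB : A ^ 2 = B ^ 2 + 1) (hexp : cexp g = A - B) : A ^ 2 = n := by
  have hn1' : (1 : ℝ) ≤ n := by exact_mod_cast hn
  set q := √(n : ℝ) + √(n - 1 : ℝ) with hq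
  have hq0 : 0 < q := by
    have := Real.sqrt_nonneg (n - 1 : ℝ)
    have : 0 < √(n:ℝ) := Real.sqrt_pos.mpr (by linarith)
    linarith
  have hqi : q⁻¹ = √(n : ℝ) - √(n - 1 : ℝ) := by
    symm
    apply eq_inv_of_mul_eq_one_left
    rw [hq]
    have h1 := Real.sq_sqrt (show (0:ℝ) ≤ n by linarith)
    have h2 := Real.sq_sqrt (show (0:ℝ) ≤ n - 1 by linarith)
    nlinarith
  have hs : q + q⁻¹ = 2 * √(n : ℝ) := by rw [hqi, hq]; ring
  have hk : (cexp ((k * Real.pi : ℝ) * I)) ^ 2 = 1 := by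
    rw [← exp_nat_mul, exp_eq_one_iff]
    exact ⟨k, by push_cast; ring⟩
  set u := cexp ((k * Real.pi : ℝ) * I) with hu
  have hu0 : u ≠ 0 := exp_ne_zero _
  have hui : u⁻¹ = u := by
    field_simp; exact hk.symm
  have hE : cexp g + (cexp g)⁻¹ = u * ((q : ℂ) + (q : ℂ)⁻¹) := by
    rw [hg, exp_add, ← hu, ← ofReal_exp]
    rcases he with rfl | rfl
    · rw [one_mul, Real.exp_log hq0, mul_inv, hui]; ring
    · rw [neg_one_mul, Real.exp_neg, Real.exp_log hq0, mul_inv, hui]; push_cast; rw [inv_inv]; ring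
  have h3 : (cexp g)⁻¹ = A + B := by
    apply inv_eq_of_mul_eq_one_right
    rw [hexp]; linear_combination hAB
  rw [h3, hexp] at hE
  have h4 : (q : ℂ) + (q : ℂ)⁻¹ = 2 * (√(n : ℝ) : ℂ) := by exact_mod_cast congrArg (fun x : ℝ => (x : ℂ)) hs
  rw [h4] at hE
  have h5 : A = u * (√(n : ℝ) : ℂ) := by linear_combination hE / 2
  have h6 : ((√(n : ℝ) : ℝ) : ℂ) ^ 2 = n := by
    exact_mod_cast congrArg (fun x : ℝ => (x : ℂ)) (Real.sq_sqrt (show (0:ℝ) ≤ n by linarith))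
  rw [h5, mul_pow, hk, h6, one_mul]

open Metric in
theorem schottky (M : ℝ) (hM : 0 < M) : ∃ C : ℝ, 0 < C ∧ ∀ f : ℂ → ℂ, DifferentiableOn ℂ f (ball 0 1) →
    (∀ z ∈ ball (0:ℂ) 1, f z ≠ 0) → (∀ z ∈ ball (0:ℂ) 1, f z ≠ 1) →
    ‖f 0‖ ≤ M → M⁻¹ ≤ ‖f 0‖ → ∀ z, ‖z‖ ≤ 1 / 2 → ‖f z‖ ≤ C := by
  set K := |Real.log M| + Real.pi + 1 with hK
  set G := Real.log (2 * (K + 1)) + Real.pi + 384 with hG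
  refine ⟨Real.exp (2 * Real.pi * Real.exp (2 * G)), by positivity, ?_⟩
  intro f hf h0 h1 hM1 hM2 z hz
  have h00 : (0:ℂ) ∈ ball (0:ℂ) 1 := mem_ball_self one_pos
  have hK1 : 1 ≤ K := by have := Real.pi_pos; have := abs_nonneg (Real.log M); linarith
  obtain ⟨g1, hg1, hg1e, hg10⟩ := exists_log_ball one_pos hf h0 (Complex.exp_log (h0 0 h00))
  set F : ℂ → ℂ := fun z => g1 z / (2 * Real.pi * I) with hF
  have hFd : DifferentiableOn ℂ F (ball 0 1) := hg1.div_const _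
  have h2pi : (2 * Real.pi * I : ℂ) ≠ 0 := by simp [Real.pi_ne_zero]
  have hFe : ∀ z ∈ ball (0:ℂ) 1, f z = cexp (2 * Real.pi * I * F z) := by
    intro z hz; rw [← hg1e z hz, hF]; congr 1; field_simp
  have hFint : ∀ z ∈ ball (0:ℂ) 1, ∀ n : ℤ, F z ≠ n := by
    intro z hz n hn
    apply h1 z hz
    rw [hFe z hz, hn, exp_eq_one_iff]; exact ⟨n, by ring⟩
  have hF0n : ‖F 0‖ ≤ K := by
    have hl := norm_log_le hM hM1 hM2
    rw [hF]; simp only [hg10, norm_div]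
    have : ‖(2 * Real.pi * I : ℂ)‖ = 2 * Real.pi := by simp [abs_of_pos Real.pi_pos]
    rw [this]
    have := Real.pi_gt_three
    refine (div_le_self (norm_nonneg _) (by linarith)).trans (hl.trans ?_)
    have := le_abs_self (Real.log M)
    linarith
  have hF0 : ∀ z ∈ ball (0:ℂ) 1, F z ≠ 0 := fun z hz => by simpa using hFint z hz 0
  have hF1 : ∀ z ∈ ball (0:ℂ) 1, F z - 1 ≠ 0 := fun z hz => by
    have := hFint z hz 1; rw [sub_ne_zero]; simpa using this
  obtain ⟨g2, hg2, hg2e, -⟩ := exists_log_ball one_pos hFd hF0 (Complex.exp_log (hF0 0 h00))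
  obtain ⟨g3, hg3, hg3e, -⟩ := exists_log_ball one_pos (hFd.sub_const 1) hF1
    (Complex.exp_log (hF1 0 h00))
  set A : ℂ → ℂ := fun z => cexp (g2 z / 2) with hA
  set B : ℂ → ℂ := fun z => cexp (g3 z / 2) with hB
  have hA2 : ∀ z ∈ ball (0:ℂ) 1, A z ^ 2 = F z := by
    intro z hz; rw [hA, ← hg2e z hz, ← exp_nat_mul]; congr 1; push_cast; ring
  have hB2 : ∀ z ∈ ball (0:ℂ) 1, B z ^ 2 = F z - 1 := by
    intro z hz; rw [hB, ← hg3e z hz, ← exp_nat_mul]; congr 1; push_cast; ring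
  have hmul : ∀ z ∈ ball (0:ℂ) 1, (A z - B z) * (A z + B z) = 1 := by
    intro z hz; linear_combination hA2 z hz - hB2 z hz
  have hHd : DifferentiableOn ℂ (fun z => A z - B z) (ball 0 1) :=
    ((hg2.div_const 2).cexp).sub ((hg3.div_const 2).cexp)
  have hH0 : ∀ z ∈ ball (0:ℂ) 1, A z - B z ≠ 0 := fun z hz h => by
    have := hmul z hz; rw [h] at this; simp at this
  obtain ⟨g, hg, hge, hg0⟩ := exists_log_ball one_pos hHd hH0 (Complex.exp_log (hH0 0 h00))
  -- the initial value of g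
  have hA0 : ‖A 0‖ ≤ K + 1 := by
    have := congrArg norm (hA2 0 h00)
    rw [norm_pow] at this
    have h3 : ‖A 0‖ ^ 2 ≤ K := this ▸ hF0n
    nlinarith [norm_nonneg (A 0)]
  have hB0 : ‖B 0‖ ≤ K + 1 := by
    have := congrArg norm (hB2 0 h00)
    rw [norm_pow] at this
    have h3 : ‖B 0‖ ^ 2 ≤ K + 1 := by
      rw [this]; exact (norm_sub_le _ _).trans (by simpa using hF0n)
    nlinarith [norm_nonneg (B 0)]
  have hg0n : ‖g 0‖ ≤ Real.log (2 * (K + 1)) + Real.pi := by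
    rw [hg0]
    apply norm_log_le (by positivity)
    · exact (norm_sub_le _ _).trans (by linarith)
    · have h3 : ‖A 0 - B 0‖⁻¹ = ‖A 0 + B 0‖ := by
        rw [← norm_inv]; congr 1; exact inv_eq_of_mul_eq_one_right (hmul 0 h00)
      have h4 : ‖A 0 - B 0‖⁻¹ ≤ 2 * (K + 1) := by
        rw [h3]; exact (norm_add_le _ _).trans (by linarith)
      exact inv_le_of_inv_le₀ (norm_pos_iff.mpr (hH0 0 h00)) h4
  -- omitted lattice
  have hno : ∀ c r, ball c r ⊆ ball (0:ℂ) 1 → ∀ w, ¬ (ball w 3 ⊆ g '' ball c r) := by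
    intro c r hcr w hw
    obtain ⟨n, k, e, hn, he, hmem⟩ := lattice_dense w
    obtain ⟨x, hx, hgx⟩ := hw hmem
    have hx1 := hcr hx
    have := lattice_value hn k he hgx (A := A x) (B := B x)
      (by rw [hA2 x hx1, hB2 x hx1]; ring) (hge x hx1)
    rw [hA2 x hx1] at this
    exact hFint x hx1 n (by simpa using this)
  have hgd : ∀ c ∈ closedBall (0:ℂ) (1 / 2), ‖deriv g c‖ ≤ 768 := by
    intro c hc
    have hsub : ball c (1 / 2) ⊆ ball (0:ℂ) 1 := by
      apply ball_subset_ball'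
      have : dist c 0 ≤ 1 / 2 := hc
      linarith
    have := bloch (by norm_num) (hg.mono hsub) (hno c (1/2) hsub)
    linarith
  have hsub : closedBall (0:ℂ) (1 / 2) ⊆ ball (0:ℂ) 1 := closedBall_subset_ball (by norm_num)
  have hzm : z ∈ closedBall (0:ℂ) (1 / 2) := by simpa using hz
  have hgz : ‖g z‖ ≤ G := by
    have h := (convex_closedBall (0:ℂ) (1 / 2)).norm_image_sub_le_of_norm_deriv_le
      (fun x hx => hg.differentiableAt (isOpen_ball.mem_nhds (hsub hx))) hgd
      (mem_closedBall_self (by norm_num)) hzm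
    have h2 : ‖g z‖ ≤ ‖g 0‖ + ‖g z - g 0‖ := by
      have := norm_add_le (g 0) (g z - g 0)
      simpa using this
    rw [sub_zero] at h
    linarith
  have hz1 := hsub hzm
  have hAz : A z = (cexp (g z) + cexp (-g z)) / 2 := by
    have : cexp (-g z) = A z + B z := by
      rw [exp_neg, hge z hz1]; exact inv_eq_of_mul_eq_one_right (hmul z hz1)
    rw [this, hge z hz1]; ring
  have hAn : ‖A z‖ ≤ Real.exp G := by
    rw [hAz, norm_div]
    have h3 : ‖cexp (g z)‖ ≤ Real.exp G := by
      refine (norm_exp_le_exp_norm _).trans (Real.exp_le_exp.mpr hgz)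
    have h4 : ‖cexp (-g z)‖ ≤ Real.exp G := by
      refine (norm_exp_le_exp_norm _).trans (Real.exp_le_exp.mpr (by rwa [norm_neg]))
    have := norm_add_le (cexp (g z)) (cexp (-g z))
    simp only [Complex.norm_ofNat]
    linarith
  rw [hFe z hz1, ← hA2 z hz1]
  refine (norm_exp_le_exp_norm _).trans (Real.exp_le_exp.mpr ?_)
  rw [norm_mul, norm_pow]
  have : ‖(2 * Real.pi * I : ℂ)‖ = 2 * Real.pi := by simp [abs_of_pos Real.pi_pos]
  rw [this, show Real.exp (2 * G) = Real.exp G ^ 2 by rw [← Real.exp_nat_mul]; norm_num]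
  gcongr

lemma gamma_sum_bound {a h y : ℝ} (ha : 0 < a) (ha1 : a ≤ 1) (hh : 0 ≤ h) (hha : 2 * h ≤ a)
    (hy : 1 ≤ y) (n : ℕ) (hn : ⌈y⌉₊ ≤ n) :
    ∑ j ∈ Finset.range (n + 1), (a + j) / ((a - h + j) ^ 2 + y ^ 2) ≤ 5 + Real.log n - Real.log y := by
  have hterm : ∀ j : ℕ, 1 ≤ j → (a + j) / ((a - h + j) ^ 2 + y ^ 2) ≤ 1 / j := by
    intro j hj
    have hj' : (1:ℝ) ≤ j := by exact_mod_cast hj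
    rw [div_le_div_iff₀ (by positivity) (by linarith)]
    nlinarith [mul_nonneg (sub_nonneg.mpr hha) (by linarith : (0:ℝ) ≤ j), sq_nonneg (a - h)]
  set m := ⌈y⌉₊ with hm
  have hmy : y ≤ m := Nat.le_ceil y
  have hmy2 : (m : ℝ) < y + 1 := Nat.ceil_lt_add_one (by linarith)
  have hm1 : 1 ≤ m := Nat.one_le_iff_ne_zero.mpr (by
    rintro h0; rw [h0] at hmy; norm_num at hmy; linarith)
  induction n, hn using Nat.le_induction with
  | base =>
    rw [Finset.sum_range_succ]
    have h1 : ∑ j ∈ Finset.range m, (a + j) / ((a - h + j) ^ 2 + y ^ 2) ≤ 4 := by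
      calc _ ≤ ∑ j ∈ Finset.range m, (m : ℝ) / y ^ 2 := by
            apply Finset.sum_le_sum
            intro j hj
            have hj' : (j : ℝ) + 1 ≤ m := by exact_mod_cast Finset.mem_range.mp hj
            apply div_le_div₀ (by positivity) (by linarith) (by positivity)
            nlinarith [sq_nonneg (a - h + j)]
        _ = m * m / y ^ 2 := by simp; ring
        _ ≤ 4 := by
            rw [div_le_iff₀ (by positivity)]
            nlinarith
    have h2 := hterm m hm1
    have h3 : (1:ℝ) / m ≤ 1 := by
      rw [div_le_one (by positivity)]; exact_mod_cast hm1
    have h4 : Real.log y ≤ Real.log m := Real.log_le_log (by linarith) hmy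
    linarith
  | succ n hn ih =>
    rw [Finset.sum_range_succ]
    have h2 := hterm (n + 1) (by lia)
    have hn0 : (0:ℝ) < n := by exact_mod_cast (by lia : 0 < n)
    have h3 : 1 / ((n + 1 : ℕ) : ℝ) ≤ Real.log ((n + 1 : ℕ) : ℝ) - Real.log n := by
      have := Real.one_sub_inv_le_log_of_pos (x := ((n + 1 : ℕ) : ℝ) / n) (by positivity)
      rw [Real.log_div (by positivity) (by positivity)] at this
      refine le_trans (le_of_eq ?_) this
      push_cast
      field_simp
      ring
    linarith

lemma gamma_ratio {a h y : ℝ} (ha : 0 < a) (ha1 : a ≤ 1) (hh : 0 ≤ h) (hha : 2 * h ≤ a)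
    (hy : 1 ≤ y) : Real.exp (2 * h * (Real.log y - 5)) * ‖Complex.Gamma ((a - h : ℝ) + y * I)‖ ≤
      ‖Complex.Gamma ((a + h : ℝ) + y * I)‖ := by
  have t1 := (GammaSeq_tendsto_Gamma ((a - h : ℝ) + y * I)).norm.const_mul
    (Real.exp (2 * h * (Real.log y - 5)))
  have t2 := (GammaSeq_tendsto_Gamma ((a + h : ℝ) + y * I)).norm
  refine le_of_tendsto_of_tendsto t1 t2 ?_
  filter_upwards [eventually_ge_atTop ⌈y⌉₊] with n hn
  have hn1 : 1 ≤ n := le_trans (Nat.one_le_iff_ne_zero.mpr (Nat.ceil_pos.mpr (by linarith)).ne') hn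
  have hn0 : (0:ℝ) < n := by exact_mod_cast hn1
  set S := ∑ j ∈ Finset.range (n + 1), (a + j) / ((a - h + j) ^ 2 + y ^ 2) with hS
  have hSb := gamma_sum_bound ha ha1 hh hha hy n hn
  have hnorm : ∀ c : ℝ, ∀ j : ℕ, ‖((c : ℝ) + y * I + j : ℂ)‖ = √((c + j) ^ 2 + y ^ 2) := by
    intro c j
    rw [show ((c : ℝ) + y * I + j : ℂ) = ((c + j : ℝ) : ℂ) + (y : ℝ) * I by push_cast; ring,
      norm_add_mul_I]
  have hseq : ∀ c : ℝ, ‖GammaSeq ((c : ℝ) + y * I) n‖ =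
      (n : ℝ) ^ c * n.factorial / ∏ j ∈ Finset.range (n + 1), √((c + j) ^ 2 + y ^ 2) := by
    intro c
    rw [GammaSeq, norm_div, norm_mul, norm_prod]
    simp only [hnorm]
    rw [norm_natCast_cpow_of_pos hn1]
    simp
  rw [hseq, hseq]
  have hprod : ∏ j ∈ Finset.range (n + 1), √((a + h + j) ^ 2 + y ^ 2) ≤
      (∏ j ∈ Finset.range (n + 1), √((a - h + j) ^ 2 + y ^ 2)) * Real.exp (2 * h * S) := by
    rw [hS, Finset.mul_sum, Real.exp_sum, ← Finset.prod_mul_distrib]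
    apply Finset.prod_le_prod
    · intros; positivity
    · intro j _
      set D := (a - h + j) ^ 2 + y ^ 2 with hD
      have hD0 : 0 < D := by positivity
      rw [Real.sqrt_le_left (by positivity), mul_pow, Real.sq_sqrt hD0.le, ← Real.exp_nat_mul]
      have := Real.add_one_le_exp ((2 : ℕ) * (2 * h * ((a + j) / D)))
      calc (a + h + j) ^ 2 + y ^ 2 = D * ((2 : ℕ) * (2 * h * ((a + j) / D)) + 1) := by
            push_cast; field_simp; rw [hD]; ring
        _ ≤ _ := by gcongr
  have hp1 : 0 < ∏ j ∈ Finset.range (n + 1), √((a + h + j) ^ 2 + y ^ 2) := by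
    apply Finset.prod_pos; intros; positivity
  have hp2 : 0 < ∏ j ∈ Finset.range (n + 1), √((a - h + j) ^ 2 + y ^ 2) := by
    apply Finset.prod_pos; intros; positivity
  set P1 := ∏ j ∈ Finset.range (n + 1), √((a + h + j) ^ 2 + y ^ 2)
  set P2 := ∏ j ∈ Finset.range (n + 1), √((a - h + j) ^ 2 + y ^ 2)
  have hpow : (n : ℝ) ^ (a + h) = (n : ℝ) ^ (a - h) * Real.exp (2 * h * Real.log n) := by
    rw [Real.rpow_def_of_pos hn0, Real.rpow_def_of_pos hn0, ← Real.exp_add]; congr 1; ring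
  have hE : Real.exp (2 * h * (Real.log y - 5)) * Real.exp (2 * h * S) ≤
      Real.exp (2 * h * Real.log n) := by
    rw [← Real.exp_add]
    apply Real.exp_le_exp.mpr
    nlinarith
  rw [← mul_div_assoc, div_le_div_iff₀ hp2 hp1, hpow]
  calc _ ≤ Real.exp (2 * h * (Real.log y - 5)) * (n ^ (a - h) * n.factorial) *
        (P2 * Real.exp (2 * h * S)) := by gcongr
    _ = (Real.exp (2 * h * (Real.log y - 5)) * Real.exp (2 * h * S)) * ((n ^ (a - h) * n.factorial) * P2) := by ring
    _ ≤ Real.exp (2 * h * Real.log n) * ((n ^ (a - h) * n.factorial) * P2) := by gcongr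
    _ = _ := by ring

lemma Lambda_conj_norm {s : ℂ} (hs : 0 < s.re) (hs1 : s.re < 1) :
    ‖riemannZeta (1 - (starRingEnd ℂ) s)‖ * ‖Gammaℝ (1 - (starRingEnd ℂ) s)‖ =
    ‖riemannZeta s‖ * ‖Gammaℝ s‖ := by
  have h0 : s ≠ 0 := by rintro rfl; simp at hs
  have h0' : 1 - s ≠ 0 := by
    intro h; have := congrArg re h; simp at this; linarith
  have e1 : riemannZeta s * Gammaℝ s = completedRiemannZeta s := by
    rw [riemannZeta_def_of_ne_zero h0, div_mul_cancel₀ _ (Gammaℝ_ne_zero_of_re_pos hs)]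
  have e2 : riemannZeta (1 - s) * Gammaℝ (1 - s) = completedRiemannZeta (1 - s) := by
    rw [riemannZeta_def_of_ne_zero h0', div_mul_cancel₀ _ (Gammaℝ_ne_zero_of_re_pos (by simpa using hs1))]
  have e3 : Gammaℝ ((starRingEnd ℂ) (1 - s)) = (starRingEnd ℂ) (Gammaℝ (1 - s)) := by
    rw [Gammaℝ_def, Gammaℝ_def, map_mul, ← Gamma_conj]
    congr 1
    · have harg : (Real.pi : ℂ).arg ≠ Real.pi := by
        rw [arg_ofReal_of_nonneg Real.pi_pos.le]; exact Real.pi_pos.ne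
      rw [← conj_ofReal Real.pi, Complex.conj_cpow _ _ harg]
      simp [map_ofNat]
    · simp [map_ofNat]
  have e4 : (1 - (starRingEnd ℂ) s) = (starRingEnd ℂ) (1 - s) := by simp
  rw [e4, riemannZeta_conj, e3, RCLike.norm_conj, RCLike.norm_conj, ← norm_mul, ← norm_mul, e1, e2,
    completedRiemannZeta_one_sub]

lemma zeta_reflect {x t : ℝ} (hx : 0 ≤ x) (hx1 : x ≤ 1 / 4) (ht : 2 ≤ t) :
    Real.exp (x * (Real.log t - 10)) * ‖riemannZeta ((1 / 2 + x : ℝ) + t * I)‖ ≤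
      ‖riemannZeta ((1 / 2 - x : ℝ) + t * I)‖ := by
  have h1 := Lambda_conj_norm (s := (1 / 2 + x : ℝ) + t * I) (by simp; linarith) (by simp; linarith)
  have e : 1 - (starRingEnd ℂ) ((1 / 2 + x : ℝ) + t * I) = (1 / 2 - x : ℝ) + t * I := by
    simp [map_ofNat]; ring
  rw [e] at h1
  have hG := gamma_ratio (a := 1 / 4) (h := x / 2) (y := t / 2) (by norm_num) (by norm_num)
    (by linarith) (by linarith) (by linarith)
  have hGn : ∀ c : ℝ, ‖Gammaℝ ((c : ℝ) + t * I)‖ = Real.pi ^ (-c / 2) * ‖Complex.Gamma ((c / 2 : ℝ) + (t / 2 : ℝ) * I)‖ := by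
    intro c
    rw [Gammaℝ_def, norm_mul, norm_cpow_eq_rpow_re_of_pos Real.pi_pos]
    congr 2
    · simp
    · push_cast; ring_nf
  rw [hGn, hGn, show (1 / 2 - x) / 2 = 1 / 4 - x / 2 by ring,
    show (1 / 2 + x) / 2 = 1 / 4 + x / 2 by ring] at h1
  set Z1 := ‖riemannZeta ((1 / 2 + x : ℝ) + t * I)‖
  set Z2 := ‖riemannZeta ((1 / 2 - x : ℝ) + t * I)‖
  set G1 := ‖Complex.Gamma ((1 / 4 - x / 2 : ℝ) + (t / 2 : ℝ) * I)‖ with hG1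
  set G2 := ‖Complex.Gamma ((1 / 4 + x / 2 : ℝ) + (t / 2 : ℝ) * I)‖
  have hG1pos : 0 < G1 := by
    apply norm_pos_iff.mpr
    apply Gamma_ne_zero_of_re_pos
    simp; linarith
  have hpi : Real.pi ^ (-(1 / 2 + x) / 2) = Real.pi ^ (-(1 / 2 - x) / 2) * Real.exp (- x * Real.log Real.pi) := by
    rw [Real.rpow_def_of_pos Real.pi_pos, Real.rpow_def_of_pos Real.pi_pos, ← Real.exp_add]; congr 1; ring
  rw [hpi] at h1
  have hpp : 0 < Real.pi ^ (-(1 / 2 - x) / 2) := Real.rpow_pos_of_pos Real.pi_pos _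
  have h2 : Z2 * G1 = Z1 * Real.exp (- x * Real.log Real.pi) * G2 := by
    apply mul_left_cancel₀ hpp.ne'
    linear_combination h1
  have hlogs : Real.exp (x * (Real.log t - 10)) ≤ Real.exp (- x * Real.log Real.pi) *
      Real.exp (2 * (x / 2) * (Real.log (t / 2) - 5)) := by
    rw [← Real.exp_add]
    apply Real.exp_le_exp.mpr
    rw [Real.log_div (by linarith) (by norm_num)]
    have hl2 : Real.log 2 ≤ 1 := by have := Real.log_two_lt_d9; linarith
    have hlpi : Real.log Real.pi ≤ 3 := by
      have := Real.log_le_sub_one_of_pos Real.pi_pos; have := Real.pi_lt_d2; linarith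
    nlinarith
  have hZ1 : 0 ≤ Z1 := norm_nonneg _
  refine le_of_mul_le_mul_right ?_ hG1pos
  calc _ ≤ Real.exp (- x * Real.log Real.pi) *
      Real.exp (2 * (x / 2) * (Real.log (t / 2) - 5)) * Z1 * G1 := by gcongr
    _ = Z1 * Real.exp (- x * Real.log Real.pi) * (Real.exp (2 * (x / 2) * (Real.log (t / 2) - 5)) * G1) := by ring
    _ ≤ Z1 * Real.exp (- x * Real.log Real.pi) * G2 := by gcongr
    _ = _ := h2.symm

lemma mellin_bound {f : ℝ → ℂ} {a b : ℝ} (ha : MellinConvergent f a) (hb : MellinConvergent f b) :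
    ∃ M : ℝ, 0 ≤ M ∧ ∀ s : ℂ, a ≤ s.re → s.re ≤ b → ‖mellin f s‖ ≤ M := by
  have hG : MeasureTheory.IntegrableOn
      (fun t : ℝ => ‖(t : ℂ) ^ ((a : ℂ) - 1) • f t‖ + ‖(t : ℂ) ^ ((b : ℂ) - 1) • f t‖) (Ioi 0) :=
    ha.norm.add hb.norm
  refine ⟨∫ t in Ioi (0 : ℝ), (‖(t : ℂ) ^ ((a : ℂ) - 1) • f t‖ + ‖(t : ℂ) ^ ((b : ℂ) - 1) • f t‖),
    ?_, ?_⟩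
  · exact MeasureTheory.integral_nonneg (fun t => by positivity)
  intro s h1 h2
  unfold mellin
  refine MeasureTheory.norm_integral_le_of_norm_le hG ?_
  refine (MeasureTheory.ae_restrict_iff' measurableSet_Ioi).mpr (Eventually.of_forall ?_)
  intro t ht
  have ht : 0 < t := ht
  simp only [norm_smul]
  rw [norm_cpow_eq_rpow_re_of_pos ht, norm_cpow_eq_rpow_re_of_pos ht,
    norm_cpow_eq_rpow_re_of_pos ht, ← add_mul]
  apply mul_le_mul_of_nonneg_right _ (norm_nonneg _)
  simp only [sub_re, one_re, ofReal_re]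
  rcases le_total 1 t with h | h
  · have := Real.rpow_le_rpow_of_exponent_le h (show s.re - 1 ≤ b - 1 by linarith)
    have h3 : 0 ≤ t ^ (a - 1) := by positivity
    linarith
  · have := Real.rpow_le_rpow_of_exponent_ge ht h (show a - 1 ≤ s.re - 1 by linarith)
    have h3 : 0 ≤ t ^ (b - 1) := by positivity
    linarith

lemma Lambda0_bdd (a b : ℝ) : ∃ M : ℝ, 0 ≤ M ∧ ∀ s : ℂ, a ≤ s.re → s.re ≤ b →
    ‖completedRiemannZeta₀ s‖ ≤ M := by
  have key : ∀ s : ℂ, MellinConvergent (HurwitzZeta.hurwitzEvenFEPair 0).f_modif s := fun s =>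
    ((HurwitzZeta.hurwitzEvenFEPair 0).isStrongFEPair_toStrongFEPair.hasMellin s).1
  obtain ⟨M, hM0, hM⟩ := mellin_bound (key (a / 2 : ℝ)) (key (b / 2 : ℝ))
  refine ⟨M, hM0, fun s h1 h2 => ?_⟩
  have := hM (s / 2) (by simp; linarith) (by simp; linarith)
  have e : completedRiemannZeta₀ s = mellin (HurwitzZeta.hurwitzEvenFEPair 0).f_modif (s / 2) / 2 := rfl
  rw [e, norm_div]
  simp only [Complex.norm_ofNat]
  linarith [norm_nonneg (mellin (HurwitzZeta.hurwitzEvenFEPair 0).f_modif (s / 2))]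

lemma norm_Gamma_le {s : ℂ} (hs : 0 < s.re) : ‖Complex.Gamma s‖ ≤ Real.Gamma s.re := by
  rw [Complex.Gamma_eq_integral hs, Real.Gamma_eq_integral hs, Complex.GammaIntegral]
  refine MeasureTheory.norm_integral_le_of_norm_le (Real.GammaIntegral_convergent hs) ?_
  refine (MeasureTheory.ae_restrict_iff' measurableSet_Ioi).mpr (Eventually.of_forall ?_)
  intro t ht
  have ht : 0 < t := ht
  rw [norm_mul, norm_cpow_eq_rpow_re_of_pos ht, Complex.norm_real]
  simp

lemma norm_sin_le (z : ℂ) : ‖Complex.sin z‖ ≤ Real.exp |z.im| := by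
  rw [Complex.sin]
  have h1 : ‖cexp (-z * I)‖ ≤ Real.exp |z.im| := by
    rw [Complex.norm_exp]; apply Real.exp_le_exp.mpr; simp; exact le_abs_self _
  have h2 : ‖cexp (z * I)‖ ≤ Real.exp |z.im| := by
    rw [Complex.norm_exp]; apply Real.exp_le_exp.mpr; simp; exact neg_le_abs _
  rw [norm_div, norm_mul]
  simp only [norm_I, mul_one, Complex.norm_ofNat]
  have := norm_sub_le (cexp (-z * I)) (cexp (z * I))
  linarith

lemma inv_GammaR_bound : ∃ C : ℝ, 0 ≤ C ∧ ∀ s : ℂ, 1 / 2 ≤ s.re → s.re ≤ 3 / 2 →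
    ‖(Gammaℝ s)⁻¹‖ ≤ C * Real.exp (Real.pi * |s.im|) := by
  have hcont : ContinuousOn Real.Gamma (Icc (1 / 4 : ℝ) (3 / 4)) := by
    intro x hx
    exact (Real.differentiableAt_Gamma (fun m => by
      have := hx.1
      have hm : (0 : ℝ) ≤ m := Nat.cast_nonneg m
      intro h; linarith)).continuousAt.continuousWithinAt
  obtain ⟨G, hG⟩ := isCompact_Icc.bddAbove_image hcont
  have hG' : ∀ x ∈ Icc (1 / 4 : ℝ) (3 / 4), Real.Gamma x ≤ G := fun x hx => hG ⟨x, hx, rfl⟩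
  have hG0 : 0 ≤ G := (Real.Gamma_pos_of_pos (by norm_num : (0 : ℝ) < 1 / 4)).le.trans
    (hG' _ ⟨le_refl _, by norm_num⟩)
  refine ⟨Real.pi * G, by positivity, fun s h1 h2 => ?_⟩
  have hpi := Real.pi_gt_three
  have e1 := Complex.Gamma_mul_Gamma_one_sub (s / 2)
  have hre : 0 < (s / 2).re := by simp; linarith
  have hg0 : Complex.Gamma (s / 2) ≠ 0 := Complex.Gamma_ne_zero_of_re_pos hre
  have hre2 : (1 - s / 2).re = 1 - s.re / 2 := by simp
  have hg1 : Complex.Gamma (1 - s / 2) ≠ 0 := Complex.Gamma_ne_zero_of_re_pos (by rw [hre2]; linarith)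
  have hpi0 : (Real.pi : ℂ) ≠ 0 := by exact_mod_cast Real.pi_ne_zero
  have hsin : Complex.sin (Real.pi * (s / 2)) ≠ 0 := by
    intro h
    rw [h, div_zero] at e1
    exact mul_ne_zero hg0 hg1 e1
  have e2 : (Complex.Gamma (s / 2))⁻¹ = Complex.Gamma (1 - s / 2) * Complex.sin (Real.pi * (s / 2)) / Real.pi := by
    apply inv_eq_of_mul_eq_one_right
    rw [mul_div_assoc', ← mul_assoc, e1]
    generalize Complex.sin (Real.pi * (s / 2)) = q at hsin
    field_simp
  rw [Gammaℝ_def, mul_inv, e2, norm_mul, norm_div, norm_mul, norm_inv, Complex.norm_real,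
    norm_cpow_eq_rpow_re_of_pos Real.pi_pos, ← Real.rpow_neg Real.pi_pos.le]
  have b1 : Real.pi ^ (-(-s / 2).re) ≤ Real.pi := by
    conv_rhs => rw [← Real.rpow_one Real.pi]
    apply Real.rpow_le_rpow_of_exponent_le (by linarith)
    simp; linarith
  have b2 : ‖Complex.Gamma (1 - s / 2)‖ ≤ G := by
    refine (norm_Gamma_le (by rw [hre2]; linarith)).trans (hG' _ ?_)
    rw [hre2]; constructor <;> linarith
  have b3 : ‖Complex.sin (Real.pi * (s / 2))‖ ≤ Real.exp (Real.pi * |s.im|) := by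
    refine (norm_sin_le _).trans (Real.exp_le_exp.mpr ?_)
    have : ((Real.pi : ℂ) * (s / 2)).im = Real.pi * (s.im / 2) := by simp
    rw [this, abs_mul, abs_of_pos Real.pi_pos, abs_div, abs_two]
    have := abs_nonneg s.im
    nlinarith
  have b4 : ‖Real.pi‖ = Real.pi := by rw [Real.norm_eq_abs, abs_of_pos Real.pi_pos]
  rw [b4]
  calc Real.pi ^ (-(-s / 2).re) * (‖Complex.Gamma (1 - s / 2)‖ * ‖Complex.sin (Real.pi * (s / 2))‖ / Real.pi)
      ≤ Real.pi * (G * Real.exp (Real.pi * |s.im|) / 1) := by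
        gcongr
        linarith
    _ = _ := by ring

/-- growth of `(s-1)ζ(s)/(s+1)`. -/
lemma zeta1_bound : ∃ C : ℝ, 0 ≤ C ∧ ∀ s : ℂ, 1 / 2 ≤ s.re → s.re ≤ 3 / 2 →
    ‖riemannZeta₁ s / (s + 1)‖ ≤ C * Real.exp (Real.pi * |s.im|) := by
  obtain ⟨M, hM0, hM⟩ := Lambda0_bdd (1 / 2) (3 / 2)
  obtain ⟨C, hC0, hC⟩ := inv_GammaR_bound
  refine ⟨(M + 3) * C + 1, by positivity, fun s h1 h2 => ?_⟩
  have hexp : 1 ≤ Real.exp (Real.pi * |s.im|) := Real.one_le_exp (by positivity)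
  by_cases hs : s = 1
  · subst hs
    rw [riemannZeta₁_one]
    have : ‖(1 : ℂ) / (1 + 1)‖ ≤ 1 := by norm_num
    refine this.trans ?_
    nlinarith [mul_nonneg (add_nonneg hM0 zero_le_three) hC0]
  have hs0 : s ≠ 0 := by
    intro h; rw [h] at h1; norm_num at h1
  have hsp : s + 1 ≠ 0 := by
    intro h
    have := congrArg re h
    simp at this; linarith
  have e1 := riemannZeta_eq_inv_sub_mul hs
  have e2 : riemannZeta s = completedRiemannZeta s / Gammaℝ s := riemannZeta_def_of_ne_zero hs0
  have hs1 : s - 1 ≠ 0 := sub_ne_zero.mpr hs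
  have hs1' : 1 - s ≠ 0 := sub_ne_zero.mpr (Ne.symm hs)
  have e3 : riemannZeta₁ s / (s + 1) =
      ((s - 1) / (s + 1) * completedRiemannZeta₀ s - (s - 1) / (s + 1) * s⁻¹ + (s + 1)⁻¹) * (Gammaℝ s)⁻¹ := by
    have : riemannZeta₁ s = (s - 1) * riemannZeta s := by rw [e1]; field_simp
    rw [this, e2, completedRiemannZeta_eq, div_eq_mul_inv _ (Gammaℝ s)]
    generalize (Gammaℝ s)⁻¹ = g
    field_simp
    ring
  have n1 : ‖(s - 1) / (s + 1)‖ ≤ 1 := by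
    rw [norm_div]
    apply div_le_one_of_le₀ _ (norm_nonneg _)
    apply (sq_le_sq₀ (norm_nonneg _) (norm_nonneg _)).mp
    rw [← normSq_eq_norm_sq, ← normSq_eq_norm_sq, normSq_apply, normSq_apply]
    simp; nlinarith
  have n2 : ‖s⁻¹‖ ≤ 2 := by
    rw [norm_inv]
    apply inv_le_of_inv_le₀ (by norm_num)
    exact le_trans (by norm_num; linarith) (re_le_norm s)
  have n3 : ‖(s + 1)⁻¹‖ ≤ 1 := by
    rw [norm_inv]
    apply inv_le_one_of_one_le₀
    refine le_trans ?_ (re_le_norm (s + 1))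
    simp; linarith
  rw [e3, norm_mul]
  have : ‖(s - 1) / (s + 1) * completedRiemannZeta₀ s - (s - 1) / (s + 1) * s⁻¹ + (s + 1)⁻¹‖ ≤ M + 3 := by
    refine (norm_add_le _ _).trans ?_
    have := norm_sub_le ((s - 1) / (s + 1) * completedRiemannZeta₀ s) ((s - 1) / (s + 1) * s⁻¹)
    rw [norm_mul, norm_mul] at this
    have a1 : ‖(s - 1) / (s + 1)‖ * ‖completedRiemannZeta₀ s‖ ≤ 1 * M := by
      gcongr; exact hM s h1 h2
    have a2 : ‖(s - 1) / (s + 1)‖ * ‖s⁻¹‖ ≤ 1 * 2 := by gcongr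
    linarith
  calc _ ≤ (M + 3) * (C * Real.exp (Real.pi * |s.im|)) := by
        gcongr; exact hC s h1 h2
    _ ≤ _ := by nlinarith

lemma LSeries_bdd {f : ℕ → ℂ} {σ : ℝ} (hf : LSeriesSummable f σ) :
    ∃ B : ℝ, 0 < B ∧ ∀ s : ℂ, s.re = σ → ‖LSeries f s‖ ≤ B := by
  refine ⟨(∑' n, ‖LSeries.term f σ n‖) + 1, by positivity, fun s hs => ?_⟩
  have e : ∀ n, ‖LSeries.term f s n‖ = ‖LSeries.term f σ n‖ := by
    intro n
    rw [LSeries.norm_term_eq, LSeries.norm_term_eq, hs, ofReal_re]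
  have hsum : Summable (fun n => ‖LSeries.term f s n‖) := by
    simp_rw [e]; exact hf.norm
  unfold LSeries
  refine (norm_tsum_le_tsum_norm hsum).trans ?_
  simp_rw [e]
  linarith

lemma zeta_upper : ∃ B : ℝ, 0 < B ∧ ∀ s : ℂ, s.re = 3 / 2 → ‖riemannZeta s‖ ≤ B := by
  obtain ⟨B, h0, h⟩ := LSeries_bdd (f := 1) (σ := 3 / 2)
    (LSeriesSummable_one_iff.mpr (by norm_num))
  refine ⟨B, h0, fun s hs => ?_⟩
  rw [← LSeries_one_eq_riemannZeta (by rw [hs]; norm_num)]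
  exact h s hs

lemma zeta_lower : ∃ m : ℝ, 0 < m ∧ ∀ s : ℂ, s.re = 5 / 4 → m ≤ ‖riemannZeta s‖ := by
  obtain ⟨B, h0, h⟩ := LSeries_bdd (f := fun n => ((ArithmeticFunction.moebius n : ℤ) : ℂ)) (σ := 5 / 4)
    (ArithmeticFunction.LSeriesSummable_moebius_iff.mpr (by norm_num))
  refine ⟨B⁻¹, inv_pos.mpr h0, fun s hs => ?_⟩
  have h1 : 1 < s.re := by rw [hs]; norm_num
  have := LSeries_one_mul_Lseries_moebius h1
  rw [LSeries_one_eq_riemannZeta h1] at this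
  have h2 := congrArg norm this
  rw [norm_mul, norm_one] at h2
  have h3 := h s hs
  rw [inv_le_iff_one_le_mul₀ h0, ← h2]
  gcongr

lemma zeta1_le {s : ℂ} (h0 : 0 ≤ s.re) (hs : s ≠ 1) :
    ‖riemannZeta₁ s / (s + 1)‖ ≤ ‖riemannZeta s‖ := by
  have hs1 : s - 1 ≠ 0 := sub_ne_zero.mpr hs
  have : riemannZeta₁ s = (s - 1) * riemannZeta s := by
    rw [riemannZeta_eq_inv_sub_mul hs]; field_simp
  rw [this, mul_div_right_comm, norm_mul]
  have n1 : ‖(s - 1) / (s + 1)‖ ≤ 1 := by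
    rw [norm_div]
    apply div_le_one_of_le₀ _ (norm_nonneg _)
    apply (sq_le_sq₀ (norm_nonneg _) (norm_nonneg _)).mp
    rw [← normSq_eq_norm_sq, ← normSq_eq_norm_sq, normSq_apply, normSq_apply]
    simp; nlinarith
  exact mul_le_of_le_one_left (norm_nonneg _) n1

lemma zeta_not_small : ∃ c : ℝ, 0 < c ∧ ∀ T : ℝ, ∃ t, T ≤ t ∧
    c ≤ ‖riemannZeta ((1 / 2 : ℝ) + t * I)‖ := by
  obtain ⟨C, hC0, hC⟩ := zeta1_bound
  obtain ⟨B, hB0, hB⟩ := zeta_upper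
  obtain ⟨m, hm0, hm⟩ := zeta_lower
  set β : ℝ := (3 * B) ^ (3 / 4 : ℝ) with hβ
  have hβ0 : 0 < β := by positivity
  set δ : ℝ := m / (4 * β) with hδ
  have hδ0 : 0 < δ := by positivity
  refine ⟨δ ^ 4 / 3, by positivity, fun T => ?_⟩
  by_contra hcon
  push Not at hcon
  set c : ℝ := δ ^ 4 / 3 with hc
  have hc0 : 0 < c := by positivity
  set K : ℝ := C * Real.exp (Real.pi * |T| + 1) with hK
  have hK0 : 0 ≤ K := by positivity
  obtain ⟨τ, hτ1, hτ2, hτ3⟩ : ∃ τ : ℝ, T + 5 ≤ τ ∧ T + K / c ≤ τ ∧ 3 ≤ τ :=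
    ⟨max (max (T + 5) (T + K / c)) 3, le_trans (le_max_left _ _) (le_max_left _ _),
      le_trans (le_max_right _ _) (le_max_left _ _), le_max_right _ _⟩
  set s0 : ℂ := (5 / 4 : ℝ) + τ * I with hs0
  have s0re : s0.re = 5 / 4 := by simp [hs0]
  have s0im : s0.im = τ := by simp [hs0]
  set F : ℂ → ℂ := fun s => riemannZeta₁ s / (s + 1) * cexp ((s - s0) ^ 2) with hF
  have hpi3 := Real.pi_gt_three
  have hpi4 := Real.pi_lt_four
  -- Gaussian norm
  have hgauss : ∀ s : ℂ, 1 / 2 ≤ s.re → s.re ≤ 3 / 2 →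
      ‖cexp ((s - s0) ^ 2)‖ ≤ Real.exp (1 - (s.im - τ) ^ 2) := by
    intro s h1 h2
    rw [Complex.norm_exp]
    apply Real.exp_le_exp.mpr
    rw [sq, mul_re, sub_re, sub_im, s0re, s0im]
    nlinarith
  have hexp1 : Real.exp 1 ≤ 3 := by have := Real.exp_one_lt_d9; linarith
  have hgauss3 : ∀ s : ℂ, 1 / 2 ≤ s.re → s.re ≤ 3 / 2 → ‖cexp ((s - s0) ^ 2)‖ ≤ 3 := by
    intro s h1 h2
    refine (hgauss s h1 h2).trans (le_trans (Real.exp_le_exp.mpr ?_) hexp1)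
    nlinarith [sq_nonneg (s.im - τ)]
  have hFb : ∀ s : ℂ, 1 / 2 ≤ s.re → s.re ≤ 3 / 2 →
      ‖F s‖ ≤ C * Real.exp (Real.pi * |s.im| + (1 - (s.im - τ) ^ 2)) := by
    intro s h1 h2
    rw [hF, Real.exp_add, ← mul_assoc]
    simp only [norm_mul]
    exact mul_le_mul (hC s h1 h2) (hgauss s h1 h2) (norm_nonneg _) (by positivity)
  have hne : ∀ s : ℂ, 0 ≤ s.re → s + 1 ≠ 0 := by
    intro s h h'
    have := congrArg re h'
    simp at this; linarith
  have key := HadamardThreeLines.norm_le_interp_of_mem_verticalClosedStrip' (f := F) (z := s0)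
    (a := 3 * c) (b := 3 * B) (l := 1 / 2) (u := 3 / 2) (by norm_num) ?_ ?_ ?_ ?_ ?_
  rotate_left
  · simp only [HadamardThreeLines.verticalClosedStrip, mem_preimage, s0re, mem_Icc]; norm_num
  · apply DifferentiableOn.diffContOnCl
    intro s hs
    have hs' : s ∈ closure (re ⁻¹' Ioo (1 / 2 : ℝ) (3 / 2)) := hs
    have hsub : closure (re ⁻¹' Ioo (1 / 2 : ℝ) (3 / 2)) ⊆ re ⁻¹' Icc (1 / 2 : ℝ) (3 / 2) :=
      closure_minimal (preimage_mono Ioo_subset_Icc_self) (isClosed_Icc.preimage continuous_re)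
    have h3 : 1 / 2 ≤ s.re := (hsub hs').1
    apply DifferentiableAt.differentiableWithinAt
    apply DifferentiableAt.mul
    · exact (differentiable_riemannZeta₁ s).div (by fun_prop) (hne s (by linarith))
    · fun_prop
  · refine ⟨C * Real.exp (Real.pi * |τ| + 11), ?_⟩
    rintro _ ⟨s, hs, rfl⟩
    refine (hFb s hs.1 hs.2).trans ?_
    gcongr ?_ * Real.exp ?_
    have : |s.im| ≤ |τ| + |s.im - τ| := by
      have := abs_add_le τ (s.im - τ)
      simpa using this
    have h5 := sq_abs (s.im - τ)
    have := abs_nonneg (s.im - τ)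
    nlinarith [sq_nonneg (|s.im - τ| - 2)]
  · intro s hs
    have hs : s.re = 1 / 2 := hs
    by_cases ht : T ≤ s.im
    · have h1 := hcon s.im ht
      have e : (((1 / 2 : ℝ) : ℂ) + s.im * I) = s := by
        rw [← hs]; exact re_add_im s
      rw [e] at h1
      have h2 := zeta1_le (s := s) (by rw [hs]; norm_num) (by
        intro h; rw [h] at hs; norm_num at hs)
      rw [hF]
      simp only [norm_mul]
      rw [mul_comm 3 c]
      exact mul_le_mul (h2.trans h1.le) (hgauss3 s (by rw [hs]) (by rw [hs]; norm_num)) (norm_nonneg _) hc0.le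
    · push Not at ht
      refine (hFb s (by rw [hs]) (by rw [hs]; norm_num)).trans ?_
      have a1 : |s.im| ≤ |T| + (τ - s.im) := by
        have := abs_add_le T (s.im - T)
        rw [add_sub_cancel, abs_of_neg (by linarith : s.im - T < 0)] at this
        linarith
      have a2 : Real.pi * |s.im| + (1 - (s.im - τ) ^ 2) ≤ (Real.pi * |T| + 1) + -(τ - T) := by
        have hu : 5 ≤ τ - s.im := by linarith
        have : Real.pi * |s.im| ≤ Real.pi * |T| + 4 * (τ - s.im) := by nlinarith
        nlinarith
      have a3 : C * Real.exp (Real.pi * |s.im| + (1 - (s.im - τ) ^ 2)) ≤ K * Real.exp (-(τ - T)) := by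
        rw [hK, mul_assoc, ← Real.exp_add]
        gcongr
      have a4 : K * Real.exp (-(τ - T)) ≤ c := by
        rw [Real.exp_neg, ← div_eq_mul_inv, div_le_iff₀ (Real.exp_pos _)]
        have : K / c ≤ τ - T := by linarith
        rw [div_le_iff₀ hc0] at this
        nlinarith [Real.add_one_le_exp (τ - T)]
      linarith
  · intro s hs
    have hs : s.re = 3 / 2 := hs
    have h2 := zeta1_le (s := s) (by rw [hs]; norm_num) (by
        intro h; rw [h] at hs; norm_num at hs)
    rw [hF]
    simp only [norm_mul]
    rw [mul_comm 3 B]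
    exact mul_le_mul (h2.trans (hB s hs)) (hgauss3 s (by rw [hs]; norm_num) (by rw [hs])) (norm_nonneg _) hB0.le
  rw [s0re] at key
  have e1 : (5 / 4 - 1 / 2 : ℝ) / (3 / 2 - 1 / 2) = 3 / 4 := by norm_num
  rw [e1, ← hβ] at key
  have e2 : (3 * c) ^ (1 - 3 / 4 : ℝ) = δ := by
    rw [hc, show 3 * (δ ^ 4 / 3) = δ ^ 4 by ring, show (1 - 3 / 4 : ℝ) = ((4 : ℕ) : ℝ)⁻¹ by norm_num]
    exact Real.pow_rpow_inv_natCast hδ0.le (by norm_num)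
  rw [e2] at key
  have e3 : δ * β = m / 4 := by rw [hδ]; field_simp
  rw [e3] at key
  have hlow : m / 2 ≤ ‖F s0‖ := by
    have hs1 : s0 ≠ 1 := by intro h; rw [h] at s0re; norm_num at s0re
    have hz : riemannZeta₁ s0 = (s0 - 1) * riemannZeta s0 := by
      have hs1 : s0 - 1 ≠ 0 := sub_ne_zero.mpr hs1
      rw [riemannZeta_eq_inv_sub_mul (by assumption)]; field_simp
    have : F s0 = (s0 - 1) / (s0 + 1) * riemannZeta s0 := by
      rw [hF]; simp only [sub_self]; rw [hz]; simp; ring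
    rw [this, norm_mul]
    have h1 : 1 / 2 ≤ ‖(s0 - 1) / (s0 + 1)‖ := by
      have hpos : 0 < ‖s0 + 1‖ := norm_pos_iff.mpr (hne s0 (by rw [s0re]; norm_num))
      rw [norm_div, le_div_iff₀ hpos]
      apply (sq_le_sq₀ (by positivity) (norm_nonneg _)).mp
      rw [mul_pow, ← normSq_eq_norm_sq, ← normSq_eq_norm_sq, normSq_apply, normSq_apply]
      simp [s0re, s0im]; nlinarith
    have := hm s0 s0re
    nlinarith [norm_nonneg (riemannZeta s0)]
  linarith

/-- the theta function on the right half plane -/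
noncomputable def Th (z : ℂ) : ℂ := jacobiTheta (I * z)

lemma Th_im (z : ℂ) : (I * z).im = z.re := by simp

lemma Th_inv {z : ℂ} (hz : 0 < z.re) : Th z⁻¹ = z ^ (1 / 2 : ℂ) * Th z := by
  have h := jacobiTheta_S_smul ⟨I * z, by rw [Th_im]; exact hz⟩
  rw [UpperHalfPlane.modular_S_smul] at h
  simp only [UpperHalfPlane.coe_mk] at h
  have hz0 : z ≠ 0 := by rintro rfl; simp at hz
  have e1 : (-(I * z))⁻¹ = I * z⁻¹ := by
    rw [← neg_mul, mul_inv, inv_neg, inv_I, neg_neg]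
  have e2 : -I * (I * z) = z := by rw [← mul_assoc]; simp
  rw [e1, e2] at h
  exact h

lemma Th_per (z : ℂ) : Th (z + 2 * I) = Th z := by
  unfold Th
  rw [← jacobiTheta_two_add (I * (z + 2 * I))]
  congr 1
  have := I_mul_I
  linear_combination 2 * this

lemma Th_hasSum {z : ℂ} (hz : 0 < z.re) :
    HasSum (fun n : ℤ => cexp (-Real.pi * (n : ℂ) ^ 2 * z)) (Th z) := by
  have h := hasSum_jacobiTheta₂_term 0 (τ := I * z) (by rw [Th_im]; exact hz)
  rw [← jacobiTheta_eq_jacobiTheta₂] at h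
  change HasSum _ (jacobiTheta (I * z))
  convert h using 2 with n
  rw [jacobiTheta₂_term]
  congr 1
  have := I_mul_I
  linear_combination (-Real.pi * (n : ℂ) ^ 2 * z) * this

lemma Th_add_I {v : ℂ} (hv : 0 < v.re) : Th (v + I) = 2 * Th (4 * v) - Th v := by
  have h1 := Th_hasSum (z := v + I) (by simpa using hv)
  have h2 := Th_hasSum (z := 4 * v) (by simpa using hv)
  have h3 := Th_hasSum hv
  classical
  have h4 : HasSum (fun n : ℤ => if Even n then cexp (-Real.pi * (n : ℂ) ^ 2 * v) else 0) (Th (4 * v)) := by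
    have hinj : Function.Injective (fun n : ℤ => 2 * n) := fun a b h => by simpa using h
    rw [← hinj.hasSum_iff]
    · convert h2 using 2 with n
      simp only [Function.comp_apply, even_two_mul, if_true]
      congr 1
      push_cast
      ring
    · intro x hx
      rw [if_neg]
      intro he
      apply hx
      obtain ⟨k, hk⟩ := he
      exact ⟨k, by simp; omega⟩
  have h5 := (h4.mul_left 2).sub h3
  refine h1.unique ?_
  refine h5.congr_fun ?_
  intro n
  have e : cexp (-Real.pi * (n : ℂ) ^ 2 * (v + I)) =
      cexp (-Real.pi * (n : ℂ) ^ 2 * v) * cexp (-Real.pi * (n : ℂ) ^ 2 * I) := by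
    rw [← Complex.exp_add]; congr 1; ring
  rw [e]
  split_ifs with hn
  · obtain ⟨k, rfl⟩ := hn
    have : cexp (-Real.pi * ((k + k : ℤ) : ℂ) ^ 2 * I) = 1 := by
      rw [Complex.exp_eq_one_iff]
      refine ⟨-(2 * k ^ 2), ?_⟩
      push_cast; ring
    rw [this]; ring
  · rw [Int.not_even_iff_odd] at hn
    obtain ⟨k, rfl⟩ := hn
    have : cexp (-Real.pi * ((2 * k + 1 : ℤ) : ℂ) ^ 2 * I) = -1 := by
      rw [← Complex.exp_pi_mul_I, Complex.exp_eq_exp_iff_exists_int]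
      refine ⟨-(2 * k ^ 2 + 2 * k + 1), ?_⟩
      push_cast; ring
    rw [this]; ring

lemma Th_bound {z : ℂ} {δ : ℝ} (hδ : 0 < δ) (hz : δ ≤ z.re) :
    ‖Th z - 1‖ ≤ 2 / (1 - Real.exp (-Real.pi * δ)) * Real.exp (-Real.pi * z.re) := by
  have h := norm_jacobiTheta_sub_one_le (τ := I * z) (by rw [Th_im]; linarith)
  rw [Th_im] at h
  refine h.trans ?_
  have h1 : Real.exp (-Real.pi * δ) < 1 := by
    rw [Real.exp_lt_one_iff]; nlinarith [Real.pi_pos]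
  have h2 : Real.exp (-Real.pi * z.re) ≤ Real.exp (-Real.pi * δ) := by
    apply Real.exp_le_exp.mpr; nlinarith [Real.pi_pos]
  gcongr

lemma Th_diff {z : ℂ} (hz : 0 < z.re) : DifferentiableAt ℂ Th z := by
  unfold Th
  have h := differentiableAt_jacobiTheta (τ := I * z) (by rw [Th_im]; exact hz)
  exact DifferentiableAt.comp z h (by fun_prop)

lemma real_mul_cpow {r : ℝ} (hr : 0 < r) {z : ℂ} (hz : z ≠ 0) (s : ℂ) :
    ((r : ℂ) * z) ^ s = (r : ℂ) ^ s * z ^ s := by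
  have hr0 : (r : ℂ) ≠ 0 := by exact_mod_cast hr.ne'
  rw [cpow_def_of_ne_zero (mul_ne_zero hr0 hz), cpow_def_of_ne_zero hr0, cpow_def_of_ne_zero hz,
    ← Complex.exp_add, Complex.log_ofReal_mul hr hz, ← Complex.ofReal_log hr.le]
  congr 1; ring

lemma sq_cpow_half {r : ℝ} (hr : 0 < r) : ((r ^ 2 : ℝ) : ℂ) ^ (1 / 2 : ℂ) = r := by
  have : (1 / 2 : ℂ) = ((1 / 2 : ℝ) : ℂ) := by push_cast; rfl
  rw [this, ← Complex.ofReal_cpow (by positivity), ← Real.sqrt_eq_rpow, Real.sqrt_sq hr.le]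

/-- the modified theta kernel -/
noncomputable def kap (z : ℂ) : ℂ := (4 * Th z - 3 * Th (9 * z) - Th (z / 9)) / 2

lemma kap_inv {z : ℂ} (hz : 0 < z.re) : kap z⁻¹ = z ^ (1 / 2 : ℂ) * kap z := by
  have hz0 : z ≠ 0 := by rintro rfl; simp at hz
  unfold kap
  have e1 : 9 * z⁻¹ = (z / 9)⁻¹ := by rw [inv_div]; rfl
  have e2 : z⁻¹ / 9 = (9 * z)⁻¹ := by rw [mul_inv]; ring
  have hre1 : 0 < (z / 9).re := by
    have : (z / 9).re = z.re / 9 := by simp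
    rw [this]; linarith
  have hre2 : 0 < (9 * z).re := by simpa using hz
  have c1 : (z / 9) ^ (1 / 2 : ℂ) = z ^ (1 / 2 : ℂ) / 3 := by
    have : z / 9 = (((1 / 3 : ℝ) ^ 2 : ℝ) : ℂ) * z := by push_cast; ring
    rw [this, real_mul_cpow (by norm_num) hz0, sq_cpow_half (by norm_num)]
    push_cast; ring
  have c2 : (9 * z) ^ (1 / 2 : ℂ) = 3 * z ^ (1 / 2 : ℂ) := by
    have : 9 * z = (((3 : ℝ) ^ 2 : ℝ) : ℂ) * z := by push_cast; ring
    rw [this, real_mul_cpow (by norm_num) hz0, sq_cpow_half (by norm_num)]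
    push_cast; ring
  rw [e1, e2, Th_inv hz, Th_inv hre1, Th_inv hre2, c1, c2]
  ring

lemma kap_diff {z : ℂ} (hz : 0 < z.re) : DifferentiableAt ℂ kap z := by
  unfold kap
  have hre1 : 0 < (z / 9).re := by
    have : (z / 9).re = z.re / 9 := by simp
    rw [this]; linarith
  have hre2 : 0 < (9 * z).re := by simpa using hz
  have d1 : DifferentiableAt ℂ (fun z => Th (9 * z)) z :=
    DifferentiableAt.comp (g := Th) z (Th_diff hre2) (by fun_prop)
  have d2 : DifferentiableAt ℂ (fun z => Th (z / 9)) z :=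
    DifferentiableAt.comp (g := Th) z (Th_diff hre1) (by fun_prop)
  exact ((((Th_diff hz).const_mul 4).sub (d1.const_mul 3)).sub d2).div_const 2

lemma kap_bound {δ : ℝ} (hδ : 0 < δ) : ∃ C : ℝ, 0 ≤ C ∧ ∀ z : ℂ, δ ≤ z.re →
    ‖kap z‖ ≤ C * Real.exp (-(Real.pi / 9) * z.re) := by
  have h1 : Real.exp (-Real.pi * (δ / 9)) < 1 := by
    rw [Real.exp_lt_one_iff]; nlinarith [Real.pi_pos]
  have h1' : 0 < 1 - Real.exp (-Real.pi * (δ / 9)) := by linarith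
  refine ⟨4 * (2 / (1 - Real.exp (-Real.pi * (δ / 9)))), by positivity, fun z hz => ?_⟩
  have hz9 : (z / 9).re = z.re / 9 := by simp
  have h9z : (9 * z).re = 9 * z.re := by simp
  have t1 := Th_bound (z := z) (δ := δ / 9) (by positivity) (by linarith)
  have t2 := Th_bound (z := 9 * z) (δ := δ / 9) (by positivity) (by rw [h9z]; linarith)
  have t3 := Th_bound (z := z / 9) (δ := δ / 9) (by positivity) (by rw [hz9]; linarith)
  rw [h9z] at t2
  rw [hz9] at t3
  set D := 2 / (1 - Real.exp (-Real.pi * (δ / 9))) with hD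
  have hD0 : 0 ≤ D := by positivity
  have hpi := Real.pi_pos
  have m1 : D * Real.exp (-Real.pi * z.re) ≤ D * Real.exp (-(Real.pi / 9) * z.re) := by
    gcongr ?_ * Real.exp ?_; nlinarith
  have m2 : D * Real.exp (-Real.pi * (9 * z.re)) ≤ D * Real.exp (-(Real.pi / 9) * z.re) := by
    gcongr ?_ * Real.exp ?_; nlinarith
  have m3 : D * Real.exp (-Real.pi * (z.re / 9)) = D * Real.exp (-(Real.pi / 9) * z.re) := by
    congr 2; ring
  have e : kap z = (4 * (Th z - 1) - 3 * (Th (9 * z) - 1) - (Th (z / 9) - 1)) / 2 := by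
    unfold kap; ring
  rw [e, norm_div, Complex.norm_ofNat]
  have n1 := norm_sub_le (4 * (Th z - 1) - 3 * (Th (9 * z) - 1)) (Th (z / 9) - 1)
  have n2 := norm_sub_le (4 * (Th z - 1)) (3 * (Th (9 * z) - 1))
  rw [norm_mul, norm_mul, Complex.norm_ofNat, Complex.norm_ofNat] at n2
  rw [mul_assoc]
  linarith

lemma kap_pow_top {δ : ℝ} (hδ : 0 < δ) (n : ℕ) : ∃ C : ℝ, 0 ≤ C ∧ ∀ z : ℂ, δ ≤ z.re →
    ‖kap z‖ * z.re ^ n ≤ C := by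
  obtain ⟨C, hC0, hC⟩ := kap_bound hδ
  refine ⟨C * (n.factorial * (9 / Real.pi) ^ n), by positivity, fun z hz => ?_⟩
  have hpi := Real.pi_pos
  have h1 := Real.pow_div_factorial_le_exp (x := Real.pi / 9 * z.re) (by
    have : 0 < z.re := by linarith
    positivity) n
  rw [div_le_iff₀ (by positivity)] at h1
  have h2 : z.re ^ n ≤ (n.factorial * (9 / Real.pi) ^ n) * Real.exp (Real.pi / 9 * z.re) := by
    calc z.re ^ n = (9 / Real.pi) ^ n * (Real.pi / 9 * z.re) ^ n := by
          rw [← mul_pow]; congr 1; field_simp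
      _ ≤ (9 / Real.pi) ^ n * (Real.exp (Real.pi / 9 * z.re) * n.factorial) := by gcongr
      _ = _ := by ring
  have hz0 : 0 ≤ z.re := by linarith
  calc ‖kap z‖ * z.re ^ n ≤ (C * Real.exp (-(Real.pi / 9) * z.re)) *
        ((n.factorial * (9 / Real.pi) ^ n) * Real.exp (Real.pi / 9 * z.re)) := by
        gcongr; exact hC z hz
    _ = C * (n.factorial * (9 / Real.pi) ^ n) *
        (Real.exp (-(Real.pi / 9) * z.re) * Real.exp (Real.pi / 9 * z.re)) := by ring
    _ = _ := by rw [← Real.exp_add]; simp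

lemma kap_poly {ρ K : ℝ} (hρ : 0 < ρ) (hK : 0 < K) (n : ℕ) : ∃ A : ℝ, 0 ≤ A ∧
    ∀ z : ℂ, ρ ≤ z.re → ‖z‖ ≤ K → ∀ x : ℝ, 0 < x →
      ‖kap (z * x)‖ ≤ A * min (x ^ n) ((x ^ n)⁻¹) := by
  obtain ⟨C1, h10, h1⟩ := kap_pow_top hρ n
  obtain ⟨C2, h20, h2⟩ := kap_pow_top (δ := ρ / K ^ 2) (by positivity) (n + 1)
  refine ⟨C1 / ρ ^ n + C2 / (ρ / K ^ 2) ^ (n + 1) / Real.sqrt ρ, by positivity, fun z hz hzK x hx => ?_⟩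
  have hzre : 0 < z.re := by linarith
  have hz0 : z ≠ 0 := by rintro rfl; simp at hzre
  have hzxre : (z * x).re = z.re * x := by simp
  rcases le_total 1 x with h | h
  · have hmin : min (x ^ n) ((x ^ n)⁻¹) = (x ^ n)⁻¹ := by
      apply min_eq_right
      have := one_le_pow₀ h (n := n)
      exact (inv_le_one_of_one_le₀ this).trans this
    rw [hmin]
    have h3 := h1 (z * x) (by rw [hzxre]; nlinarith)
    rw [hzxre] at h3
    have h4 : ‖kap (z * x)‖ * (ρ * x) ^ n ≤ C1 := by
      refine le_trans ?_ h3
      gcongr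
    rw [mul_pow] at h4
    have h5 : ‖kap (z * x)‖ ≤ C1 / ρ ^ n * (x ^ n)⁻¹ := by
      rw [← div_eq_mul_inv, div_div, le_div_iff₀ (by positivity)]
      exact h4
    refine h5.trans ?_
    gcongr
    have : 0 ≤ C2 / (ρ / K ^ 2) ^ (n + 1) / Real.sqrt ρ := by positivity
    linarith
  · have hmin : min (x ^ n) ((x ^ n)⁻¹) = x ^ n := by
      apply min_eq_left
      have := pow_le_one₀ hx.le h (n := n)
      exact this.trans (one_le_inv_iff₀.mpr ⟨by positivity, this⟩)
    rw [hmin]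
    set w : ℂ := (z * x)⁻¹ with hw
    have hwre : w.re = z.re / ‖z‖ ^ 2 / x := by
      rw [hw, mul_inv, ← ofReal_inv, re_mul_ofReal, inv_re, normSq_eq_norm_sq, div_eq_mul_inv _ x]
    have hznorm : 0 < ‖z‖ := norm_pos_iff.mpr hz0
    have hq : ρ / K ^ 2 ≤ z.re / ‖z‖ ^ 2 := by gcongr
    have hq0 : 0 < ρ / K ^ 2 := by positivity
    have hwre2 : ρ / K ^ 2 / x ≤ w.re := by rw [hwre]; gcongr
    have hwre1 : ρ / K ^ 2 ≤ w.re := by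
      refine le_trans ?_ hwre2
      rw [le_div_iff₀ hx]; nlinarith
    have hw0 : 0 < w.re := by linarith
    have e1 : kap (z * x) = w ^ (1 / 2 : ℂ) * kap w := by
      rw [← kap_inv hw0, hw, inv_inv]
    have h3 := h2 w hwre1
    have h4 : ‖kap w‖ * (ρ / K ^ 2 / x) ^ (n + 1) ≤ C2 := by
      refine le_trans ?_ h3
      gcongr
    have h5 : ‖kap w‖ ≤ C2 / (ρ / K ^ 2) ^ (n + 1) * x ^ (n + 1) := by
      rw [div_pow, mul_div_assoc', div_le_iff₀ (by positivity)] at h4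
      rw [div_mul_eq_mul_div, le_div_iff₀ (by positivity)]
      exact h4
    have hwn : ‖w‖ ≤ 1 / (ρ * x) := by
      rw [hw, norm_inv, norm_mul, norm_real, Real.norm_of_nonneg hx.le, one_div]
      have := (re_le_norm z)
      gcongr
      linarith
    have hwz : w ≠ 0 := by rintro h; rw [h] at hw0; simp at hw0
    have h6 : ‖w ^ (1 / 2 : ℂ)‖ ≤ 1 / (Real.sqrt ρ * Real.sqrt x) := by
      have : (1 / 2 : ℂ) = ((1 / 2 : ℝ) : ℂ) := by push_cast; rfl
      rw [this, Complex.norm_cpow_real, ← Real.sqrt_eq_rpow, ← Real.sqrt_mul hρ.le]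
      refine (Real.sqrt_le_sqrt hwn).trans (le_of_eq ?_)
      rw [Real.sqrt_div zero_le_one, Real.sqrt_one]
    have hsx : x ≤ Real.sqrt x := by
      apply Real.le_sqrt_of_sq_le; nlinarith
    have hsx0 : 0 < Real.sqrt x := Real.sqrt_pos.mpr hx
    have hsr0 : 0 < Real.sqrt ρ := Real.sqrt_pos.mpr hρ
    rw [e1, norm_mul]
    calc ‖w ^ (1 / 2 : ℂ)‖ * ‖kap w‖ ≤ 1 / (Real.sqrt ρ * Real.sqrt x) *
          (C2 / (ρ / K ^ 2) ^ (n + 1) * x ^ (n + 1)) := by gcongr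
      _ = (C2 / (ρ / K ^ 2) ^ (n + 1) / Real.sqrt ρ) * x ^ n * (x / Real.sqrt x) := by
          rw [pow_succ x n]; field_simp
      _ ≤ (C2 / (ρ / K ^ 2) ^ (n + 1) / Real.sqrt ρ) * x ^ n * 1 := by
          gcongr
          exact div_le_one_of_le₀ hsx hsx0.le
      _ ≤ _ := by
          rw [mul_one]
          gcongr
          have : 0 ≤ C1 / ρ ^ n := by positivity
          linarith

lemma Th_near : ∃ C : ℝ, 0 ≤ C ∧ ∀ u : ℂ, 1 ≤ u.re → |u.im| ≤ 1 → ‖Th (u⁻¹ + I)‖ ≤ C := by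
  set D := 2 / (1 - Real.exp (-Real.pi * (1 / 4))) with hD
  have hpi := Real.pi_gt_three
  have h1 : Real.exp (-Real.pi * (1 / 4)) < 1 := by
    rw [Real.exp_lt_one_iff]; nlinarith [Real.pi_pos]
  have h1' : 0 < 1 - Real.exp (-Real.pi * (1 / 4)) := by linarith
  have hD0 : 0 ≤ D := by positivity
  refine ⟨8 * D, by positivity, fun u hu1 hu2 => ?_⟩
  have hu0 : 0 < u.re := by linarith
  have huz : u ≠ 0 := by rintro rfl; simp at hu0
  have hre4 : (u / 4).re = u.re / 4 := by simp
  have hinv : 0 < (u⁻¹).re := by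
    rw [inv_re]; exact div_pos hu0 (normSq_pos.mpr huz)
  have c1 : (u / 4) ^ (1 / 2 : ℂ) = u ^ (1 / 2 : ℂ) / 2 := by
    have : u / 4 = (((1 / 2 : ℝ) ^ 2 : ℝ) : ℂ) * u := by push_cast; ring
    rw [this, real_mul_cpow (by norm_num) huz, sq_cpow_half (by norm_num)]
    push_cast; ring
  have e1 : 4 * u⁻¹ = (u / 4)⁻¹ := by rw [inv_div]; rfl
  have e : Th (u⁻¹ + I) = u ^ (1 / 2 : ℂ) * ((Th (u / 4) - 1) - (Th u - 1)) := by
    rw [Th_add_I hinv, e1, Th_inv (by rw [hre4]; linarith), Th_inv hu0, c1]; ring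
  have t1 := Th_bound (z := u) (δ := 1 / 4) (by norm_num) (by linarith)
  have t2 := Th_bound (z := u / 4) (δ := 1 / 4) (by norm_num) (by rw [hre4]; linarith)
  rw [hre4] at t2
  rw [← hD] at t1 t2
  have m1 : D * Real.exp (-Real.pi * u.re) ≤ D * Real.exp (-Real.pi * (u.re / 4)) := by
    gcongr ?_ * Real.exp ?_; nlinarith
  have hn : ‖u‖ ≤ 2 * u.re := by
    have := norm_le_abs_re_add_abs_im u
    rw [abs_of_pos hu0] at this
    linarith
  have h6 : ‖u ^ (1 / 2 : ℂ)‖ ≤ 2 * u.re := by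
    have : (1 / 2 : ℂ) = ((1 / 2 : ℝ) : ℂ) := by push_cast; rfl
    rw [this, Complex.norm_cpow_real, ← Real.sqrt_eq_rpow]
    apply Real.sqrt_le_iff.mpr
    constructor
    · linarith
    · nlinarith
  have h7 : u.re * Real.exp (-Real.pi * (u.re / 4)) ≤ 2 := by
    have := Real.add_one_le_exp (Real.pi * (u.re / 4))
    have e9 : Real.exp (-Real.pi * (u.re / 4)) = (Real.exp (Real.pi * (u.re / 4)))⁻¹ := by
      rw [← Real.exp_neg]; congr 1; ring
    rw [e9, ← div_eq_mul_inv, div_le_iff₀ (Real.exp_pos _)]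
    nlinarith
  rw [e, norm_mul]
  have n1 := norm_sub_le (Th (u / 4) - 1) (Th u - 1)
  calc ‖u ^ (1 / 2 : ℂ)‖ * ‖(Th (u / 4) - 1) - (Th u - 1)‖
      ≤ (2 * u.re) * (2 * (D * Real.exp (-Real.pi * (u.re / 4)))) := by
        gcongr; linarith
    _ = 4 * D * (u.re * Real.exp (-Real.pi * (u.re / 4))) := by ring
    _ ≤ 4 * D * 2 := by gcongr
    _ = _ := by ring

lemma min_pow_int (n : ℕ) {σ : ℝ} (h1 : σ < n) (h2 : -(n : ℝ) < σ) :
    MeasureTheory.IntegrableOn (fun x : ℝ => x ^ (σ - 1) * min (x ^ n) ((x ^ n)⁻¹)) (Ioi 0) := by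
  apply mellin_convergent_of_isBigO_scalar (a := n) (b := -n) _ _ h1 _ h2
  · apply ContinuousOn.locallyIntegrableOn _ measurableSet_Ioi
    refine ContinuousOn.inf (by fun_prop) (ContinuousOn.inv₀ (by fun_prop) ?_)
    intro x hx; exact pow_ne_zero _ (ne_of_gt hx)
  · apply Asymptotics.IsBigO.of_bound 1
    filter_upwards [eventually_ge_atTop (1 : ℝ)] with x hx
    have hx0 : 0 < x := by linarith
    rw [Real.rpow_neg hx0.le, Real.rpow_natCast, one_mul, Real.norm_of_nonneg (by positivity),
      Real.norm_of_nonneg (by positivity)]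
    exact min_le_right _ _
  · apply Asymptotics.IsBigO.of_bound 1
    filter_upwards [self_mem_nhdsWithin] with x hx
    have hx0 : 0 < x := hx
    rw [neg_neg, Real.rpow_natCast, one_mul, Real.norm_of_nonneg (by positivity),
      Real.norm_of_nonneg (by positivity)]
    exact min_le_left _ _

lemma re_mul_pos {z : ℂ} (hz : 0 < z.re) {x : ℝ} (hx : 0 < x) : 0 < (z * x).re := by
  rw [re_mul_ofReal]; positivity

lemma isOpen_rhp : IsOpen {z : ℂ | 0 < z.re} := isOpen_lt continuous_const continuous_re

lemma cpow_cont (s : ℂ) : ContinuousOn (fun x : ℝ => (x : ℂ) ^ (s - 1)) (Ioi 0) := by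
  intro x hx
  apply ContinuousAt.continuousWithinAt
  exact continuousAt_ofReal_cpow_const _ _ (Or.inr (ne_of_gt hx))

lemma kap_comp_cont {z : ℂ} (hz : 0 < z.re) : ContinuousOn (fun x : ℝ => kap (z * x)) (Ioi 0) := by
  intro x hx
  apply ContinuousAt.continuousWithinAt
  exact ContinuousAt.comp (g := kap) (f := fun x : ℝ => z * (x : ℂ))
    (kap_diff (re_mul_pos hz hx)).continuousAt (by fun_prop)

lemma kap_conv {z : ℂ} (hz : 0 < z.re) (s : ℂ) : MellinConvergent (fun x : ℝ => kap (z * x)) s := by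
  obtain ⟨n, hn⟩ := exists_nat_gt |s.re|
  rw [abs_lt] at hn
  have hz0 : z ≠ 0 := by rintro rfl; simp at hz
  obtain ⟨A, hA0, hA⟩ := kap_poly hz (norm_pos_iff.mpr hz0) n
  refine MeasureTheory.Integrable.mono' ((min_pow_int n hn.2 hn.1).const_mul A) ?_ ?_
  · apply ContinuousOn.aestronglyMeasurable _ measurableSet_Ioi
    exact (cpow_cont s).smul (kap_comp_cont hz)
  · filter_upwards [MeasureTheory.ae_restrict_mem measurableSet_Ioi] with x hx
    rw [norm_smul, norm_cpow_eq_rpow_re_of_pos hx, sub_re, one_re]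
    have := hA z le_rfl le_rfl x hx
    have hx' : 0 < x := hx
    calc _ ≤ x ^ (s.re - 1) * (A * min (x ^ n) ((x ^ n)⁻¹)) := by gcongr
      _ = _ := by ring

lemma kap_mellin_diff (s : ℂ) {z₀ : ℂ} (hz : 0 < z₀.re) :
    DifferentiableAt ℂ (fun z => mellin (fun x : ℝ => kap (z * x)) s) z₀ := by
  obtain ⟨n, hn⟩ := exists_nat_gt |s.re|
  rw [abs_lt] at hn
  have hz0 : z₀ ≠ 0 := by rintro rfl; simp at hz
  set r := z₀.re / 4 with hr
  have hr0 : 0 < r := by positivity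
  obtain ⟨A, hA0, hA⟩ := kap_poly (ρ := z₀.re / 2) (K := ‖z₀‖ + z₀.re) (by positivity) (by positivity) n
  have hball : ∀ z ∈ Metric.ball z₀ r, ∀ w ∈ Metric.closedBall z r, z₀.re / 2 ≤ w.re ∧ ‖w‖ ≤ ‖z₀‖ + z₀.re := by
    intro z hz1 w hw
    rw [Metric.mem_ball, dist_eq] at hz1
    rw [Metric.mem_closedBall, dist_eq] at hw
    have h3 : ‖w - z₀‖ ≤ 2 * r := by
      have := norm_add_le (w - z) (z - z₀)
      rw [sub_add_sub_cancel] at this; linarith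
    constructor
    · have := (abs_le.mp (abs_re_le_norm (w - z₀))).1
      rw [sub_re] at this; linarith
    · have := norm_add_le (w - z₀) z₀
      rw [sub_add_cancel] at this; linarith
  have hre : ∀ z ∈ Metric.ball z₀ r, 0 < z.re := by
    intro z hz1
    have := (hball z hz1 z (Metric.mem_closedBall_self hr0.le)).1
    linarith
  have hder : ∀ z : ℂ, 0 < z.re → ∀ x : ℝ, 0 < x →
      HasDerivAt (fun w : ℂ => kap (w * x)) (deriv kap (z * x) * x) z := by
    intro z hz x hx
    have h1 := (kap_diff (re_mul_pos hz hx)).hasDerivAt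
    have h2 : HasDerivAt (fun w : ℂ => w * (x : ℂ)) (x : ℂ) z := by
      simpa using (hasDerivAt_id z).mul_const (x : ℂ)
    exact HasDerivAt.comp z h1 h2
  have hdc : ContinuousOn (deriv kap) {z : ℂ | 0 < z.re} := by
    have : DifferentiableOn ℂ kap {z : ℂ | 0 < z.re} := fun z hz => (kap_diff hz).differentiableWithinAt
    exact (this.deriv isOpen_rhp).continuousOn
  have key := hasDerivAt_integral_of_dominated_loc_of_deriv_le (𝕜 := ℂ) (x₀ := z₀)
    (μ := MeasureTheory.volume.restrict (Ioi (0 : ℝ)))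
    (F := fun z (x : ℝ) => (x : ℂ) ^ (s - 1) • kap (z * x))
    (F' := fun z (x : ℝ) => (x : ℂ) ^ (s - 1) • (deriv kap (z * x) * x))
    (bound := fun x => A / r * (x ^ (s.re - 1) * min (x ^ n) ((x ^ n)⁻¹)))
    (Metric.ball_mem_nhds z₀ hr0) ?_ (kap_conv hz s) ?_ ?_ ((min_pow_int n hn.2 hn.1).const_mul _) ?_
  · exact key.2.differentiableAt
  · filter_upwards [Metric.ball_mem_nhds z₀ hr0] with z hz
    exact (kap_conv (hre z hz) s).aestronglyMeasurable
  · apply ContinuousOn.aestronglyMeasurable _ measurableSet_Ioi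
    refine (cpow_cont s).smul (ContinuousOn.mul ?_ (by fun_prop))
    exact hdc.comp (f := fun x : ℝ => z₀ * (x : ℂ)) (by fun_prop) (fun x hx => re_mul_pos hz hx)
  · filter_upwards [MeasureTheory.ae_restrict_mem measurableSet_Ioi] with x hx z hz1
    have hx' : 0 < x := hx
    rw [norm_smul, norm_cpow_eq_rpow_re_of_pos hx, sub_re, one_re, ← (hder z (hre z hz1) x hx).deriv]
    have := norm_deriv_le_of_forall_mem_sphere_norm_le (f := fun w : ℂ => kap (w * x)) (c := z)
      (C := A * min (x ^ n) ((x ^ n)⁻¹)) hr0 ?_ ?_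
    · calc _ ≤ x ^ (s.re - 1) * (A * min (x ^ n) ((x ^ n)⁻¹) / r) := by gcongr
        _ = _ := by ring
    · apply DifferentiableOn.diffContOnCl_ball (U := Metric.closedBall z r) _ Subset.rfl
      intro w hw
      have := (hball z hz1 w hw).1
      exact (hder w (by linarith) x hx).differentiableAt.differentiableWithinAt
    · intro w hw
      have := hball z hz1 w (Metric.sphere_subset_closedBall hw)
      exact hA w this.1 this.2 x hx
  · filter_upwards [MeasureTheory.ae_restrict_mem measurableSet_Ioi] with x hx z hz1
    exact (hder z (hre z hz1) x hx).const_smul ((x : ℂ) ^ (s - 1))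

lemma kap_rot (s : ℂ) {z : ℂ} (hz : 0 < z.re) :
    mellin (fun x : ℝ => kap (z * x)) s = z ^ (-s) * mellin (fun x : ℝ => kap x) s := by
  have hpre : IsPreconnected {z : ℂ | 0 < z.re} := (convex_halfSpace_re_gt 0).isPreconnected
  have a1 : AnalyticOnNhd ℂ (fun z => mellin (fun x : ℝ => kap (z * x)) s) {z : ℂ | 0 < z.re} := by
    apply DifferentiableOn.analyticOnNhd _ isOpen_rhp
    intro w hw
    exact (kap_mellin_diff s hw).differentiableWithinAt
  have a2 : AnalyticOnNhd ℂ (fun z => z ^ (-s) * mellin (fun x : ℝ => kap x) s) {z : ℂ | 0 < z.re} := by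
    apply DifferentiableOn.analyticOnNhd _ isOpen_rhp
    intro w hw
    apply DifferentiableAt.differentiableWithinAt
    apply DifferentiableAt.mul_const
    exact (differentiableAt_id.cpow_const (Or.inl hw))
  have hreal : ∀ y : ℝ, 0 < y → mellin (fun x : ℝ => kap ((y : ℂ) * x)) s =
      (y : ℂ) ^ (-s) * mellin (fun x : ℝ => kap x) s := by
    intro y hy
    have := mellin_comp_mul_left (fun x : ℝ => kap x) s hy
    rw [smul_eq_mul] at this
    rw [← this]
    simp only [ofReal_mul]
  refine a1.eqOn_of_preconnected_of_frequently_eq a2 hpre (z₀ := 1) (by simp) ?_ hz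
  have hseq : Tendsto (fun k : ℕ => ((1 + 1 / ((k : ℝ) + 1) : ℝ) : ℂ)) atTop (𝓝[≠] 1) := by
    apply tendsto_nhdsWithin_of_tendsto_nhds_of_eventually_within
    · have h := tendsto_one_div_add_atTop_nhds_zero_nat (𝕜 := ℝ)
      have h2 := h.const_add (1 : ℝ)
      have h3 := (continuous_ofReal.tendsto _).comp h2
      simpa [Function.comp_def] using h3
    · filter_upwards with k
      have : (0 : ℝ) < 1 / ((k : ℝ) + 1) := by positivity
      simp only [mem_compl_iff, mem_singleton_iff]
      intro h
      have h' : (1 + 1 / ((k : ℝ) + 1) : ℝ) = 1 := by exact_mod_cast h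
      linarith
  refine hseq.frequently (Frequently.of_forall fun k => ?_)
  exact hreal _ (by positivity)

lemma Th_mellin {s : ℂ} (hs : 1 / 2 < s.re) :
    HasMellin (fun x : ℝ => Th x - 1) s (2 * completedRiemannZeta (2 * s)) := by
  have h := (HurwitzZeta.hurwitzEvenFEPair 0).hasMellin (s := s) hs
  have e1 : (HurwitzZeta.hurwitzEvenFEPair 0).Λ s = 2 * completedRiemannZeta (2 * s) := by
    rw [completedRiemannZeta, HurwitzZeta.completedHurwitzZetaEven, mul_div_cancel_left₀ _ (two_ne_zero)]
    ring
  have e2 : (fun x : ℝ => (HurwitzZeta.hurwitzEvenFEPair 0).f x - (HurwitzZeta.hurwitzEvenFEPair 0).f₀)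
      = fun x : ℝ => Th x - 1 := by
    funext x
    have e3 : (HurwitzZeta.hurwitzEvenFEPair 0).f₀ = 1 := by
      simp [HurwitzZeta.hurwitzEvenFEPair]
    have e4 : (HurwitzZeta.hurwitzEvenFEPair 0).f x = Th x := by
      change ((HurwitzZeta.evenKernel 0 x : ℝ) : ℂ) = _
      have := HurwitzZeta.evenKernel_def 0 x
      simp only [QuotientAddGroup.mk_zero] at this
      rw [this, Th, jacobiTheta_eq_jacobiTheta₂]
      simp
    rw [e3, e4]
  rw [e1, e2] at h
  exact h

/-- the Dirichlet polynomial factor -/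
noncomputable def Pf (s : ℂ) : ℂ := 4 - 3 * ((9 : ℝ) : ℂ) ^ (-s) - ((1 / 9 : ℝ) : ℂ) ^ (-s)

lemma kap_mellin_right {s : ℂ} (hs : 1 / 2 < s.re) :
    mellin (fun x : ℝ => kap x) s = Pf s * completedRiemannZeta (2 * s) := by
  obtain ⟨c1, m1⟩ := Th_mellin hs
  have c2 := (MellinConvergent.comp_mul_left (f := fun x : ℝ => Th x - 1) (s := s) (a := 9) (by norm_num)).mpr c1
  have c3 := (MellinConvergent.comp_mul_left (f := fun x : ℝ => Th x - 1) (s := s) (a := 1 / 9) (by norm_num)).mpr c1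
  have m2 := mellin_comp_mul_left (fun x : ℝ => Th x - 1) s (a := 9) (by norm_num)
  have m3 := mellin_comp_mul_left (fun x : ℝ => Th x - 1) s (a := 1 / 9) (by norm_num)
  have h4 := hasMellin_const_smul c1 (4 : ℂ)
  have h3 := hasMellin_const_smul c2 (3 : ℂ)
  have h43 := hasMellin_sub h4.1 h3.1
  have hh := hasMellin_sub h43.1 c3
  have e : (fun x : ℝ => kap x) = fun x : ℝ => ((4 : ℂ) • (Th x - 1) - (3 : ℂ) • (Th ((9 * x : ℝ) : ℂ) - 1)
      - (Th ((1 / 9 * x : ℝ) : ℂ) - 1)) / 2 := by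
    funext x
    unfold kap
    push_cast
    have : (x : ℂ) / 9 = 1 / 9 * x := by ring
    rw [this]
    simp only [smul_eq_mul]
    ring
  rw [e, mellin_div_const, hh.2, h43.2, h4.2, h3.2, m2, m3, m1]
  simp only [smul_eq_mul, Pf]
  ring

lemma kap_mellin_entire : Differentiable ℂ (mellin (fun x : ℝ => kap x)) := by
  intro s
  obtain ⟨n, hn⟩ := exists_nat_gt |s.re|
  rw [abs_lt] at hn
  obtain ⟨A, hA0, hA⟩ := kap_poly (ρ := 1) (K := 1) one_pos one_pos n
  have hA' : ∀ x : ℝ, 0 < x → ‖kap x‖ ≤ A * min (x ^ n) ((x ^ n)⁻¹) := by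
    intro x hx
    have := hA 1 (by simp) (by simp) x hx
    rwa [one_mul] at this
  apply mellin_differentiableAt_of_isBigO_rpow (a := n) (b := -n) _ _ hn.2 _ hn.1
  · apply ContinuousOn.locallyIntegrableOn _ measurableSet_Ioi
    have := kap_comp_cont (z := 1) (by simp)
    simpa only [one_mul] using this
  · apply Asymptotics.IsBigO.of_bound A
    filter_upwards [eventually_ge_atTop (1 : ℝ)] with x hx
    have hx0 : 0 < x := by linarith
    rw [Real.rpow_neg hx0.le, Real.rpow_natCast,
      Real.norm_of_nonneg (by positivity)]
    refine (hA' x hx0).trans ?_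
    gcongr
    exact min_le_right _ _
  · apply Asymptotics.IsBigO.of_bound A
    filter_upwards [self_mem_nhdsWithin] with x hx
    have hx0 : 0 < x := hx
    rw [neg_neg, Real.rpow_natCast,
      Real.norm_of_nonneg (by positivity)]
    refine (hA' x hx0).trans ?_
    gcongr
    exact min_le_left _ _

lemma kap_mellin {s : ℂ} (hs0 : s ≠ 0) (hs1 : s ≠ 1 / 2) :
    mellin (fun x : ℝ => kap x) s = Pf s * completedRiemannZeta (2 * s) := by
  have hid : ∀ w : ℂ, w ≠ 0 → w ≠ 1 / 2 → (2 * w) * (2 * w - 1) * completedRiemannZeta (2 * w) =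
      (2 * w) * (2 * w - 1) * completedRiemannZeta₀ (2 * w) + 1 := by
    intro w h0 h1
    have h2 : 1 - 2 * w ≠ 0 := by
      intro h; apply h1; linear_combination -h / 2
    rw [completedRiemannZeta_eq]
    field_simp
    ring
  have a1 : AnalyticOnNhd ℂ (fun w => (2 * w) * (2 * w - 1) * mellin (fun x : ℝ => kap x) w) univ := by
    apply DifferentiableOn.analyticOnNhd _ isOpen_univ
    have := kap_mellin_entire
    apply Differentiable.differentiableOn
    fun_prop
  have a2 : AnalyticOnNhd ℂ (fun w => Pf w * ((2 * w) * (2 * w - 1) * completedRiemannZeta₀ (2 * w) + 1)) univ := by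
    apply DifferentiableOn.analyticOnNhd _ isOpen_univ
    have h1 : Differentiable ℂ (fun w : ℂ => completedRiemannZeta₀ (2 * w)) :=
      differentiable_completedZeta₀.comp (by fun_prop)
    have h2 : Differentiable ℂ Pf := by
      unfold Pf
      refine Differentiable.sub (Differentiable.sub (by fun_prop) (Differentiable.const_mul ?_ _)) ?_
      · exact Differentiable.const_cpow (by fun_prop) (Or.inl (by norm_num))
      · exact Differentiable.const_cpow (by fun_prop) (Or.inl (by norm_num))
    apply Differentiable.differentiableOn
    fun_prop
  have hev : (fun w => (2 * w) * (2 * w - 1) * mellin (fun x : ℝ => kap x) w) =ᶠ[𝓝 (1 : ℂ)]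
      (fun w => Pf w * ((2 * w) * (2 * w - 1) * completedRiemannZeta₀ (2 * w) + 1)) := by
    have ho : IsOpen {w : ℂ | 1 / 2 < w.re} := isOpen_lt continuous_const continuous_re
    filter_upwards [ho.mem_nhds (show (1 : ℂ) ∈ {w : ℂ | 1 / 2 < w.re} by simp; norm_num)] with w hw
    have hw' : 1 / 2 < w.re := hw
    rw [kap_mellin_right hw, ← hid w]
    · ring
    · rintro rfl; simp at hw'; linarith
    · rintro rfl; simp at hw'
  have := a1.eqOn_of_preconnected_of_eventuallyEq a2 isPreconnected_univ (mem_univ 1) hev (mem_univ s)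
  simp only at this
  rw [← hid s hs0 hs1] at this
  have hne : (2 * s) * (2 * s - 1) ≠ 0 := by
    refine mul_ne_zero (mul_ne_zero two_ne_zero hs0) ?_
    intro h; apply hs1; linear_combination h / 2
  apply mul_left_cancel₀ hne
  rw [this]; ring

/-- the critical line function, complex valued -/
noncomputable def gC (u : ℝ) : ℂ := mellin (fun x : ℝ => kap x) ((1 / 4 : ℝ) + u * I)

lemma Pf_line (u : ℝ) : Pf ((1 / 4 : ℝ) + u * I) =
    ((4 - 2 * Real.exp (Real.log 9 / 4) * Real.cos (u * Real.log 9) : ℝ) : ℂ) := by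
  unfold Pf
  have h9 : ((9 : ℝ) : ℂ) ≠ 0 := by norm_num
  have h19 : ((1 / 9 : ℝ) : ℂ) ≠ 0 := by norm_num
  rw [cpow_def_of_ne_zero h9, cpow_def_of_ne_zero h19, ← Complex.ofReal_log (by norm_num),
    ← Complex.ofReal_log (by norm_num), one_div 9, Real.log_inv]
  set L := Real.log 9 with hL
  have h3 : (3 : ℂ) = cexp ((L / 2 : ℝ) : ℂ) := by
    rw [← Complex.ofReal_exp]
    have : Real.exp (L / 2) = 3 := by
      have : L / 2 = Real.log 3 := by
        rw [hL, show (9 : ℝ) = 3 ^ 2 by norm_num, Real.log_pow]; push_cast; ring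
      rw [this, Real.exp_log (by norm_num)]
    rw [this]; norm_num
  have e : ((4 - 2 * Real.exp (L / 4) * Real.cos (u * L) : ℝ) : ℂ) =
      4 - cexp ((L / 4 : ℝ) : ℂ) * (2 * Complex.cos ((u * L : ℝ) : ℂ)) := by
    push_cast; ring
  rw [e, Complex.two_cos, h3, mul_add, ← Complex.exp_add, ← Complex.exp_add, ← Complex.exp_add,
    sub_sub, add_comm (cexp _)]
  congr 3
  · push_cast; ring
  · push_cast; ring

lemma exp_L4 : Real.exp (Real.log 9 / 4) < 2 := by
  have h : Real.exp (Real.log 9 / 4) ^ 4 = 9 := by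
    rw [← Real.exp_nat_mul]; push_cast
    rw [mul_div_cancel₀ _ (by norm_num), Real.exp_log (by norm_num)]
  by_contra hc
  push Not at hc
  have : (2 : ℝ) ^ 4 ≤ Real.exp (Real.log 9 / 4) ^ 4 := by gcongr
  rw [h] at this; norm_num at this

lemma gC_eq (u : ℝ) : gC u = Pf ((1 / 4 : ℝ) + u * I) * completedRiemannZeta ((1 / 2 : ℝ) + (2 * u : ℝ) * I) := by
  unfold gC
  rw [kap_mellin]
  · congr 2; push_cast; ring
  · intro h; have := congrArg re h; simp at this
  · intro h; have := congrArg re h; norm_num at this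

lemma Lam_eq (t : ℝ) : completedRiemannZeta ((1 / 2 : ℝ) + t * I) =
    riemannZeta ((1 / 2 : ℝ) + t * I) * Gammaℝ ((1 / 2 : ℝ) + t * I) := by
  rw [riemannZeta_def_of_ne_zero, div_mul_cancel₀ _ (Gammaℝ_ne_zero_of_re_pos (by simp))]
  intro h; have := congrArg re h; simp at this

lemma Lam_even (t : ℝ) : completedRiemannZeta ((1 / 2 : ℝ) + (-t : ℝ) * I) =
    completedRiemannZeta ((1 / 2 : ℝ) + t * I) := by
  rw [← completedRiemannZeta_one_sub]
  congr 1; push_cast; ring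

lemma GammaR_conj (s : ℂ) : Gammaℝ ((starRingEnd ℂ) s) = (starRingEnd ℂ) (Gammaℝ s) := by
  rw [Gammaℝ_def, Gammaℝ_def, map_mul, ← Complex.Gamma_conj]
  have hpi : (Real.pi : ℂ).arg ≠ Real.pi := by
    rw [Complex.arg_ofReal_of_nonneg Real.pi_pos.le]; exact Real.pi_pos.ne
  congr 1
  · rw [← conj_ofReal Real.pi, Complex.conj_cpow _ _ hpi]
    simp [map_ofNat]
  · simp [map_ofNat]

lemma Lam_conj (t : ℝ) : (starRingEnd ℂ) (completedRiemannZeta ((1 / 2 : ℝ) + t * I)) =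
    completedRiemannZeta ((1 / 2 : ℝ) + t * I) := by
  conv_rhs => rw [← Lam_even]
  rw [Lam_eq t, map_mul, ← riemannZeta_conj, ← GammaR_conj, Lam_eq (-t)]
  have : (starRingEnd ℂ) ((1 / 2 : ℝ) + t * I) = (1 / 2 : ℝ) + (-t : ℝ) * I := by
    rw [map_add, map_mul, conj_ofReal, conj_ofReal, conj_I]; push_cast; ring
  rw [this]

lemma gC_even (u : ℝ) : gC (-u) = gC u := by
  rw [gC_eq, gC_eq, Pf_line, Pf_line, neg_mul, Real.cos_neg, mul_neg, Lam_even]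

/-- the critical line function, real valued -/
noncomputable def gR (u : ℝ) : ℝ := (gC u).re

lemma gC_real (u : ℝ) : gC u = (gR u : ℂ) := by
  unfold gR
  symm
  rw [← Complex.conj_eq_iff_re, gC_eq, map_mul, Lam_conj, Pf_line, conj_ofReal]

lemma gR_even (u : ℝ) : gR (-u) = gR u := by unfold gR; rw [gC_even]

lemma gR_cont : Continuous gR := by
  unfold gR gC
  have := kap_mellin_entire.continuous
  fun_prop

lemma Gamma_quarter : ∃ c : ℝ, 0 < c ∧ ∀ y : ℝ, 1 ≤ y →
    c * Real.exp (-(Real.pi / 2) * y) / Real.sqrt y ≤ ‖Complex.Gamma ((1 / 4 : ℝ) + y * I)‖ := by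
  refine ⟨Real.sqrt (Real.pi / (2 * Real.exp (5 / 2))), by positivity, fun y hy => ?_⟩
  have hy0 : 0 < y := by linarith
  set G := ‖Complex.Gamma ((1 / 4 : ℝ) + y * I)‖ with hG
  have hG0 : 0 ≤ G := norm_nonneg _
  have h1 := Complex.Gamma_mul_Gamma_one_sub ((1 / 4 : ℝ) + y * I)
  have h1n := congrArg norm h1
  rw [norm_mul, norm_div, ← hG] at h1n
  have e1 : ‖Complex.Gamma (1 - ((1 / 4 : ℝ) + y * I))‖ = ‖Complex.Gamma ((1 - 1 / 4 : ℝ) + y * I)‖ := by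
    rw [← Complex.norm_conj, ← Complex.Gamma_conj]
    congr 2
    simp only [map_sub, map_one, map_add, map_mul, conj_ofReal, conj_I]
    push_cast; ring
  have h2 := gamma_ratio (a := 1) (h := 1 / 4) (y := y) (by norm_num) (by norm_num) (by norm_num) (by norm_num) hy
  have e2 : Complex.Gamma ((1 + 1 / 4 : ℝ) + y * I) = ((1 / 4 : ℝ) + y * I) * Complex.Gamma ((1 / 4 : ℝ) + y * I) := by
    rw [← Complex.Gamma_add_one]
    · congr 1; push_cast; ring
    · intro h; have := congrArg re h; simp at this
  rw [e2, norm_mul, ← hG] at h2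
  have e3 : ‖((1 / 4 : ℝ) : ℂ) + y * I‖ ≤ 2 * y := by
    have := norm_add_le ((1 / 4 : ℝ) : ℂ) (y * I)
    rw [norm_mul, norm_I, norm_real, norm_real, Real.norm_of_nonneg hy0.le, Real.norm_of_nonneg (by norm_num)] at this
    linarith
  have e4 : Real.exp (2 * (1 / 4) * (Real.log y - 5)) = Real.sqrt y / Real.exp (5 / 2) := by
    rw [show 2 * (1 / 4) * (Real.log y - 5) = Real.log y * (1 / 2) - 5 / 2 by ring, Real.exp_sub,
      Real.exp_mul, Real.exp_log hy0, Real.sqrt_eq_rpow]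
  rw [e4] at h2
  set H := ‖Complex.Gamma ((1 - 1 / 4 : ℝ) + y * I)‖ with hH
  have hH0 : 0 ≤ H := norm_nonneg _
  have hs : ‖Complex.sin (Real.pi * ((1 / 4 : ℝ) + y * I))‖ ≤ Real.exp (Real.pi * y) := by
    refine (norm_sin_le _).trans (le_of_eq ?_)
    congr 1
    rw [im_ofReal_mul]
    simp only [add_im, ofReal_im, zero_add, mul_im, ofReal_re, I_im, I_re, mul_one, mul_zero, add_zero]
    exact abs_of_nonneg (by positivity)
  have hs0 : 0 < ‖Complex.sin (Real.pi * ((1 / 4 : ℝ) + y * I))‖ := by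
    rw [norm_pos_iff]
    intro h
    rw [h, div_zero] at h1
    rcases mul_eq_zero.mp h1 with h | h
    · exact Complex.Gamma_ne_zero_of_re_pos (by simp) h
    · exact Complex.Gamma_ne_zero_of_re_pos (by simp; norm_num) h
  rw [e1, norm_real, Real.norm_of_nonneg Real.pi_pos.le] at h1n
  have h3 : Real.pi * Real.exp (-Real.pi * y) ≤ G * H := by
    rw [h1n, neg_mul, Real.exp_neg, ← div_eq_mul_inv]
    gcongr
  have hsy : 0 < Real.sqrt y := Real.sqrt_pos.mpr hy0
  have hsq : Real.sqrt y * Real.sqrt y = y := Real.mul_self_sqrt hy0.le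
  have h4 : H ≤ 2 * Real.exp (5 / 2) * Real.sqrt y * G := by
    have h5 : Real.sqrt y / Real.exp (5 / 2) * H ≤ 2 * y * G := h2.trans (by gcongr)
    rw [div_mul_eq_mul_div, div_le_iff₀ (Real.exp_pos _)] at h5
    have h6 : Real.sqrt y * H ≤ Real.sqrt y * (2 * Real.exp (5 / 2) * Real.sqrt y * G) := by
      calc _ ≤ 2 * y * G * Real.exp (5 / 2) := h5
        _ = 2 * (Real.sqrt y * Real.sqrt y) * G * Real.exp (5 / 2) := by rw [hsq]
        _ = _ := by ring
    exact le_of_mul_le_mul_left h6 hsy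
  have h7 : Real.pi * Real.exp (-Real.pi * y) ≤ 2 * Real.exp (5 / 2) * y * G ^ 2 := by
    have hle : Real.sqrt y ≤ y := Real.sqrt_le_iff.mpr ⟨hy0.le, by nlinarith⟩
    calc _ ≤ G * (2 * Real.exp (5 / 2) * Real.sqrt y * G) := h3.trans (by gcongr)
      _ = 2 * Real.exp (5 / 2) * Real.sqrt y * G ^ 2 := by ring
      _ ≤ _ := by gcongr
  apply abs_le_of_sq_le_sq' _ hG0 |>.2
  rw [div_pow, mul_pow, Real.sq_sqrt (by positivity), Real.sq_sqrt hy0.le, ← Real.exp_nat_mul,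
    div_le_iff₀ hy0, div_mul_eq_mul_div, div_le_iff₀ (by positivity)]
  have : ((2 : ℕ) : ℝ) * (-(Real.pi / 2) * y) = -Real.pi * y := by push_cast; ring
  rw [this]
  linarith

lemma gR_lower : ∃ c : ℝ, 0 < c ∧ ∀ u : ℝ, 1 ≤ u →
    c * ‖riemannZeta ((1 / 2 : ℝ) + (2 * u : ℝ) * I)‖ * Real.exp (-(Real.pi / 2) * u) / Real.sqrt u ≤ |gR u| := by
  obtain ⟨c, hc, h⟩ := Gamma_quarter
  have hp : 0 < 4 - 2 * Real.exp (Real.log 9 / 4) := by linarith [exp_L4]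
  refine ⟨(4 - 2 * Real.exp (Real.log 9 / 4)) * Real.pi ^ (-(1 / 4) : ℝ) * c, by positivity, fun u hu => ?_⟩
  have e1 : |gR u| = ‖gC u‖ := by rw [gC_real, norm_real, Real.norm_eq_abs]
  have h1 := h u hu
  have e2 : ‖Gammaℝ ((1 / 2 : ℝ) + (2 * u : ℝ) * I)‖ = Real.pi ^ (-(1 / 4) : ℝ) * ‖Complex.Gamma ((1 / 4 : ℝ) + u * I)‖ := by
    rw [Gammaℝ_def, norm_mul, norm_cpow_eq_rpow_re_of_pos Real.pi_pos]
    congr 2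
    · simp; norm_num
    · congr 1; push_cast; ring
  have e3 : 4 - 2 * Real.exp (Real.log 9 / 4) ≤ ‖Pf ((1 / 4 : ℝ) + u * I)‖ := by
    rw [Pf_line, norm_real, Real.norm_eq_abs]
    refine le_trans ?_ (le_abs_self _)
    have := Real.cos_le_one (u * Real.log 9)
    nlinarith [Real.exp_pos (Real.log 9 / 4)]
  rw [e1, gC_eq, Lam_eq, norm_mul, norm_mul, e2]
  set Z := ‖riemannZeta ((1 / 2 : ℝ) + (2 * u : ℝ) * I)‖
  calc _ = (4 - 2 * Real.exp (Real.log 9 / 4)) * (Z * (Real.pi ^ (-(1 / 4) : ℝ) *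
        (c * Real.exp (-(Real.pi / 2) * u) / Real.sqrt u))) := by ring
    _ ≤ _ := by gcongr

lemma exp_re_pos {φ : ℝ} (h0 : 0 ≤ φ) (h1 : φ < Real.pi / 2) : 0 < (cexp (φ * I)).re := by
  rw [exp_ofReal_mul_I_re]
  exact Real.cos_pos_of_mem_Ioo ⟨by linarith [Real.pi_pos], h1⟩

lemma line_rot {φ : ℝ} (h0 : 0 ≤ φ) (h1 : φ < Real.pi / 2) (u : ℝ) :
    mellin (fun x : ℝ => kap (cexp (φ * I) * x)) ((1 / 4 : ℝ) + u * I) =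
    cexp ((-φ / 4 : ℝ) * I) * ((Real.exp (φ * u) * gR u : ℝ) : ℂ) := by
  rw [kap_rot _ (exp_re_pos h0 h1)]
  change _ * gC u = _
  rw [gC_real, cpow_def_of_ne_zero (Complex.exp_ne_zero _), Complex.log_exp]
  · push_cast
    rw [← mul_assoc, ← Complex.exp_add]
    congr 2
    have := I_mul_I
    linear_combination (-φ * u : ℂ) * this
  · simp; linarith [Real.pi_pos]
  · simp; linarith [Real.pi_pos]

lemma gR_bound {φ : ℝ} (h0 : 0 ≤ φ) (h1 : φ < Real.pi / 2) : ∃ M : ℝ, 0 ≤ M ∧ ∀ u : ℝ,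
    |gR u| ≤ M * Real.exp (-φ * |u|) := by
  have hc := kap_conv (exp_re_pos h0 h1) ((1 / 4 : ℝ) : ℂ)
  obtain ⟨M, hM0, hM⟩ := mellin_bound hc hc
  have hM' : ∀ u : ℝ, Real.exp (φ * u) * |gR u| ≤ M := by
    intro u
    have := hM ((1 / 4 : ℝ) + u * I) (by simp) (by simp)
    rw [line_rot h0 h1, norm_mul, norm_exp_ofReal_mul_I, one_mul, norm_real, norm_mul,
      Real.norm_eq_abs, Real.norm_eq_abs, Real.abs_exp] at this
    exact this
  refine ⟨M, hM0, fun u => ?_⟩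
  have h : Real.exp (φ * |u|) * |gR u| ≤ M := by
    rcases abs_cases u with ⟨h, _⟩ | ⟨h, _⟩
    · rw [h]; exact hM' u
    · rw [h, ← gR_even]; exact hM' (-u)
  rw [neg_mul, Real.exp_neg, ← div_eq_mul_inv, le_div_iff₀ (Real.exp_pos _)]
  linarith

lemma exp_abs_int {δ : ℝ} (hδ : 0 < δ) : MeasureTheory.Integrable (fun u : ℝ => Real.exp (-δ * |u|)) := by
  rw [← MeasureTheory.integrableOn_univ, ← Iic_union_Ioi (a := (0 : ℝ))]
  refine MeasureTheory.IntegrableOn.union ?_ ?_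
  · refine (integrableOn_exp_mul_Iic hδ 0).congr_fun ?_ measurableSet_Iic
    intro u hu
    simp only
    rw [abs_of_nonpos hu]; congr 1; ring
  · refine (integrableOn_exp_mul_Ioi (a := -δ) (by linarith) 0).congr_fun ?_ measurableSet_Ioi
    intro u hu
    simp only
    rw [abs_of_pos hu]

lemma gR_int {φ : ℝ} (h0 : 0 ≤ φ) (h1 : φ < Real.pi / 2) :
    MeasureTheory.Integrable (fun u : ℝ => Real.exp (φ * u) * gR u) := by
  obtain ⟨M, hM0, hM⟩ := gR_bound (φ := (φ + Real.pi / 2) / 2) (by linarith) (by linarith)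
  refine ((exp_abs_int (δ := (Real.pi / 2 - φ) / 2) (by linarith)).const_mul M).mono' ?_ ?_
  · have := gR_cont
    exact (by fun_prop : Continuous (fun u : ℝ => Real.exp (φ * u) * gR u)).aestronglyMeasurable
  · filter_upwards with u
    rw [norm_mul, Real.norm_eq_abs, Real.norm_eq_abs, Real.abs_exp]
    have h2 : Real.exp (φ * u) ≤ Real.exp (φ * |u|) := by
      apply Real.exp_le_exp.mpr
      exact mul_le_mul_of_nonneg_left (le_abs_self u) h0
    calc _ ≤ Real.exp (φ * |u|) * (M * Real.exp (-((φ + Real.pi / 2) / 2) * |u|)) := by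
          gcongr; exact hM u
      _ = M * (Real.exp (φ * |u|) * Real.exp (-((φ + Real.pi / 2) / 2) * |u|)) := by ring
      _ = _ := by rw [← Real.exp_add]; congr 2; ring

lemma gR_inversion {φ : ℝ} (h0 : 0 ≤ φ) (h1 : φ < Real.pi / 2) :
    |∫ u : ℝ, Real.exp (φ * u) * gR u| ≤ 2 * Real.pi * ‖kap (cexp (φ * I))‖ := by
  have hre := exp_re_pos h0 h1
  have hF : (fun u : ℝ => mellin (fun x : ℝ => kap (cexp (φ * I) * x)) ((1 / 4 : ℝ) + u * I)) =
      fun u : ℝ => cexp ((-φ / 4 : ℝ) * I) * ((Real.exp (φ * u) * gR u : ℝ) : ℂ) :=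
    funext fun u => line_rot h0 h1 u
  have hv : VerticalIntegrable (mellin (fun x : ℝ => kap (cexp (φ * I) * x))) (1 / 4) := by
    unfold VerticalIntegrable
    rw [hF]
    exact ((gR_int h0 h1).ofReal).const_mul _
  have hinv := mellinInv_mellin_eq (1 / 4) (fun x : ℝ => kap (cexp (φ * I) * x)) (x := 1) one_pos
    (kap_conv hre _) hv ((kap_comp_cont hre).continuousAt (Ioi_mem_nhds one_pos))
  unfold mellinInv at hinv
  simp only [ofReal_one, one_cpow, one_smul, mul_one] at hinv
  rw [hF, MeasureTheory.integral_const_mul, integral_complex_ofReal] at hinv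
  have hn := congrArg norm hinv
  rw [norm_smul, norm_mul, norm_exp_ofReal_mul_I, one_mul] at hn
  have e : ‖((∫ u : ℝ, Real.exp (φ * u) * gR u : ℝ) : ℂ)‖ = |∫ u : ℝ, Real.exp (φ * u) * gR u| := by
    rw [norm_real, Real.norm_eq_abs]
  have hpi := Real.pi_pos
  rw [Real.norm_of_nonneg (by positivity), one_div] at hn
  rw [← hn, ← mul_assoc, mul_inv_cancel₀ (by positivity), one_mul]
  exact e.ge

lemma kap_near : ∃ C : ℝ, 0 ≤ C ∧ ∀ φ : ℝ, 0 ≤ φ → φ < Real.pi / 2 → Real.cos φ ≤ 1 / 18 →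
    ‖kap (cexp (φ * I))‖ ≤ C := by
  obtain ⟨C, hC0, hC⟩ := Th_near
  refine ⟨8 * C, by positivity, fun φ h0 h1 h2 => ?_⟩
  have hx : 0 < Real.cos φ := Real.cos_pos_of_mem_Ioo ⟨by linarith [Real.pi_pos], h1⟩
  have hy0 : 0 ≤ Real.sin φ := Real.sin_nonneg_of_nonneg_of_le_pi h0 (by linarith [Real.pi_pos])
  have hsq := Real.sin_sq_add_cos_sq φ
  have hzeq : cexp (φ * I) = (Real.cos φ : ℂ) + Real.sin φ * I := by
    rw [Complex.exp_mul_I]; push_cast; rfl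
  set x := Real.cos φ with hxd
  set y := Real.sin φ with hyd
  have hy1 : y < 1 := by nlinarith
  rw [hzeq]
  set R := (1 + y) / (2 * x) with hR
  have hR9 : 9 ≤ R := by rw [hR, le_div_iff₀ (by positivity)]; linarith
  have hRx : R * (2 * x) = 1 + y := by rw [hR]; field_simp
  set v : ℂ := (x : ℂ) + (y - 1 : ℝ) * I with hv
  set u : ℂ := (R : ℂ) + (1 / 2 : ℝ) * I with hu
  have huv : u * v = 1 := by
    have hxR : x * R = (1 + y) / 2 := by linarith
    have h3 : R * (1 - y) = x / 2 := by
      have : (2 * x) * (R * (1 - y)) = (2 * x) * (x / 2) := by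
        calc (2 * x) * (R * (1 - y)) = (R * (2 * x)) * (1 - y) := by ring
          _ = (1 + y) * (1 - y) := by rw [hRx]
          _ = (2 * x) * (x / 2) := by nlinarith
      exact mul_left_cancel₀ (by positivity) this
    apply Complex.ext
    · simp [hu, hv]; linarith
    · simp [hu, hv]; linarith
  have hu0 : u ≠ 0 := left_ne_zero_of_mul_eq_one huv
  have hui : u⁻¹ = v := inv_eq_of_mul_eq_one_right huv
  have hure : u.re = R := by simp [hu]
  have huim : u.im = 1 / 2 := by simp [hu]
  have hz : (x : ℂ) + y * I = v + I := by rw [hv]; push_cast; ring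
  -- first term
  have b1 : ‖Th (x + y * I)‖ ≤ C := by
    rw [hz, ← hui]
    apply hC
    · rw [hure]; linarith
    · rw [huim, abs_of_pos (by norm_num)]; norm_num
  have hre9 : (u / 9).re = R / 9 := by rw [← hure]; simp
  have him9 : (u / 9).im = 1 / 18 := by
    have : (u / 9).im = u.im / 9 := by simp
    rw [this, huim]; norm_num
  have b2 : ‖Th (9 * (x + y * I))‖ ≤ C := by
    have e : 9 * ((x : ℂ) + y * I) = ((u / 9)⁻¹ + I) + 2 * I + 2 * I + 2 * I + 2 * I := by
      rw [hz, inv_div, div_eq_mul_inv, hui]; ring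
    rw [e, Th_per, Th_per, Th_per, Th_per]
    apply hC
    · rw [hre9]; linarith
    · rw [him9, abs_of_pos (by norm_num)]; norm_num
  have b3 : ‖Th ((x + y * I) / 9)‖ ≤ 9 * C := by
    set w : ℂ := (starRingEnd ℂ) ((x : ℂ) + y * I) with hw
    have hwz : ((x : ℂ) + y * I) * w = 1 := by
      rw [hw, Complex.mul_conj, normSq_add_mul_I]
      norm_cast; linarith
    have hz0 : (x : ℂ) + y * I ≠ 0 := left_ne_zero_of_mul_eq_one hwz
    have hw0 : w ≠ 0 := right_ne_zero_of_mul_eq_one hwz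
    have e : ((x : ℂ) + y * I) / 9 = (9 * w)⁻¹ := by
      rw [mul_inv, ← eq_inv_of_mul_eq_one_left hwz]; ring
    have hwre : 0 < (9 * w).re := by rw [hw]; simp; linarith
    rw [e, Th_inv hwre, norm_mul]
    have hwn : ‖w‖ = 1 := by
      rw [hw, RCLike.norm_conj, ← hzeq, norm_exp_ofReal_mul_I]
    have n1 : ‖(9 * w) ^ (1 / 2 : ℂ)‖ ≤ 9 := by
      have : (1 / 2 : ℂ) = ((1 / 2 : ℝ) : ℂ) := by push_cast; rfl
      rw [this, Complex.norm_cpow_real, ← Real.sqrt_eq_rpow, norm_mul, hwn, Complex.norm_ofNat]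
      rw [Real.sqrt_le_iff]; norm_num
    have hw9 : ‖Th (9 * w)‖ ≤ C := by
      rw [← Th_per, ← Th_per, ← Th_per, ← Th_per, ← Th_per]
      have e2 : 9 * w + 2 * I + 2 * I + 2 * I + 2 * I + 2 * I = ((starRingEnd ℂ) (u / 9))⁻¹ + I := by
        rw [← map_inv₀, inv_div, div_eq_mul_inv, hui, hw, hz, map_add, map_mul, conj_I, map_ofNat]
        ring
      rw [e2]
      apply hC
      · rw [conj_re, hre9]; linarith
      · rw [conj_im, him9, abs_neg, abs_of_pos (by norm_num)]; norm_num
    gcongr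
  unfold kap
  rw [norm_div, Complex.norm_ofNat]
  have n1 := norm_sub_le (4 * Th (x + y * I) - 3 * Th (9 * (x + y * I))) (Th ((x + y * I) / 9))
  have n2 := norm_sub_le (4 * Th (x + y * I)) (3 * Th (9 * (x + y * I)))
  rw [norm_mul, norm_mul, Complex.norm_ofNat, Complex.norm_ofNat] at n2
  linarith

lemma gR_contra {U c' : ℝ} (hU : 1 ≤ U) (hc : 0 < c') (ε : ℝ) (hε : |ε| = 1)
    (h : ∀ u, U ≤ u → c' * Real.exp (-(Real.pi / 2) * u) / Real.sqrt u ≤ ε * gR u) : False := by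
  obtain ⟨C, hC0, hC⟩ := kap_near
  have hpi := Real.pi_gt_three
  have hIg0 : MeasureTheory.Integrable (fun u => |gR u|) := by
    have := (gR_int (φ := 0) le_rfl (by linarith)).abs
    simpa using this
  set J := ∫ u, |gR u| with hJ
  set B := 2 * Real.pi * C + Real.exp (Real.pi / 2 * U) * J with hB
  have hmain : ∀ N : ℝ, 2 * U ≤ N → c' * Real.sqrt N / 4 ≤ B := by
    intro N hN
    have hN0 : 0 < N := by linarith
    have hsN : 0 < Real.sqrt N := Real.sqrt_pos.mpr hN0
    -- choose φ
    set η := 1 / (36 * N) with hη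
    have hη0 : 0 < η := by positivity
    have hη1 : η ≤ 1 / 36 := by
      rw [hη]; apply one_div_le_one_div_of_le (by norm_num); linarith
    have hηN : η * N = 1 / 36 := by rw [hη]; field_simp
    set φ := Real.pi / 2 - η with hφ
    have hφ0 : 0 ≤ φ := by linarith
    have hφ1 : φ < Real.pi / 2 := by linarith
    have hcos : Real.cos φ ≤ 1 / 18 := by
      rw [hφ, Real.cos_pi_div_two_sub]
      have := Real.sin_le hη0.le
      linarith
    have hk := (gR_inversion hφ0 hφ1).trans (mul_le_mul_of_nonneg_left (hC φ hφ0 hφ1 hcos) (by positivity))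
    have hIg := gR_int hφ0 hφ1
    have hIgε : MeasureTheory.Integrable (fun u => ε * (Real.exp (φ * u) * gR u)) := hIg.const_mul ε
    have htot : ∫ u, ε * (Real.exp (φ * u) * gR u) ≤ 2 * Real.pi * C := by
      rw [MeasureTheory.integral_const_mul]
      refine (le_abs_self _).trans ?_
      rw [abs_mul, hε, one_mul]; exact hk
    have hsplit := MeasureTheory.integral_add_compl (measurableSet_Ici (a := U)) hIgε
    have hleft : -(Real.exp (Real.pi / 2 * U) * J) ≤ ∫ u in (Ici U)ᶜ, ε * (Real.exp (φ * u) * gR u) := by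
      have h1 : ‖∫ u in (Ici U)ᶜ, ε * (Real.exp (φ * u) * gR u)‖ ≤
          ∫ u in (Ici U)ᶜ, Real.exp (Real.pi / 2 * U) * |gR u| := by
        apply MeasureTheory.norm_integral_le_of_norm_le
        · exact (hIg0.const_mul _).integrableOn
        · filter_upwards [MeasureTheory.ae_restrict_mem measurableSet_Ici.compl] with u hu
          simp only [mem_compl_iff, mem_Ici, not_le] at hu
          rw [norm_mul, norm_mul, Real.norm_eq_abs, hε, one_mul, Real.norm_eq_abs, Real.norm_eq_abs, Real.abs_exp]
          have hle : φ * u ≤ Real.pi / 2 * U := by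
            calc φ * u ≤ φ * U := by gcongr
              _ ≤ Real.pi / 2 * U := by gcongr
          have := Real.exp_le_exp.mpr hle
          gcongr
      have h2 : ∫ u in (Ici U)ᶜ, Real.exp (Real.pi / 2 * U) * |gR u| ≤ Real.exp (Real.pi / 2 * U) * J := by
        rw [hJ, ← MeasureTheory.integral_const_mul]
        apply MeasureTheory.setIntegral_le_integral (hIg0.const_mul _)
        filter_upwards with u
        positivity
      have h3 := (abs_le.mp (h1.trans h2)).1
      exact h3
    have hpos : ∀ u, U ≤ u → 0 ≤ ε * (Real.exp (φ * u) * gR u) := by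
      intro u hu
      have hu0 : 0 < u := by linarith
      have := h u hu
      have h3 : 0 ≤ ε * gR u := le_trans (by positivity) this
      calc 0 ≤ Real.exp (φ * u) * (ε * gR u) := by positivity
        _ = _ := by ring
    have hright : c' / (2 * Real.sqrt N) * (N - U) ≤ ∫ u in Ici U, ε * (Real.exp (φ * u) * gR u) := by
      have h1 : ∫ u in Icc U N, ε * (Real.exp (φ * u) * gR u) ≤ ∫ u in Ici U, ε * (Real.exp (φ * u) * gR u) := by
        apply MeasureTheory.setIntegral_mono_set hIgε.integrableOn
        · filter_upwards [MeasureTheory.ae_restrict_mem measurableSet_Ici] with u hu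
          exact hpos u hu
        · exact Icc_subset_Ici_self.eventuallyLE
      refine le_trans ?_ h1
      have h2 : ∫ u in Icc U N, c' / (2 * Real.sqrt N) = c' / (2 * Real.sqrt N) * (N - U) := by
        rw [MeasureTheory.setIntegral_const, smul_eq_mul, Real.volume_real_Icc_of_le (by linarith)]
        ring
      rw [← h2]
      apply MeasureTheory.setIntegral_mono_on _ hIgε.integrableOn measurableSet_Icc
      · intro u hu
        have hu0 : 0 < u := by linarith [hu.1]
        have h3 := h u hu.1
        have h4 : (1 : ℝ) / 2 ≤ Real.exp (φ * u) * Real.exp (-(Real.pi / 2) * u) := by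
          rw [← Real.exp_add]
          have e : φ * u + -(Real.pi / 2) * u = -(η * u) := by rw [hφ]; ring
          rw [e]
          have : η * u ≤ η * N := by gcongr; exact hu.2
          have := Real.add_one_le_exp (-(η * u))
          linarith
        have h5 : Real.sqrt u ≤ Real.sqrt N := Real.sqrt_le_sqrt hu.2
        have hsu : 0 < Real.sqrt u := Real.sqrt_pos.mpr hu0
        calc c' / (2 * Real.sqrt N) = c' * (1 / 2) / Real.sqrt N := by field_simp
          _ ≤ c' * (Real.exp (φ * u) * Real.exp (-(Real.pi / 2) * u)) / Real.sqrt u := by gcongr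
          _ = Real.exp (φ * u) * (c' * Real.exp (-(Real.pi / 2) * u) / Real.sqrt u) := by ring
          _ ≤ Real.exp (φ * u) * (ε * gR u) := by gcongr
          _ = _ := by ring
      · exact continuousOn_const.integrableOn_Icc
    have hfin : c' * Real.sqrt N / 4 ≤ c' / (2 * Real.sqrt N) * (N - U) := by
      have hs2 : Real.sqrt N * Real.sqrt N = N := Real.mul_self_sqrt hN0.le
      rw [div_mul_eq_mul_div, le_div_iff₀ (by positivity)]
      have : c' * Real.sqrt N / 4 * (2 * Real.sqrt N) = c' * (N / 2) := by
        rw [← hs2]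
        rw [hs2]
        linear_combination (c' / 2) * hs2
      rw [this]
      gcongr
      linarith
    linarith
  have hev := Real.tendsto_sqrt_atTop.eventually_gt_atTop (4 * B / c')
  obtain ⟨N, hN1, hN2⟩ := (hev.and (eventually_ge_atTop (2 * U))).exists
  have := hmain N hN2
  rw [div_lt_iff₀ hc] at hN1
  linarith

lemma zeta_small {c : ℝ} (hc : 0 < c) (T : ℝ) :
    ∃ t, T ≤ t ∧ ‖riemannZeta ((1 / 2 : ℝ) + t * I)‖ < c := by
  by_contra hcon
  push Not at hcon
  obtain ⟨c0, hc0, hlow⟩ := gR_lower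
  set U := max T 1 with hUd
  have hU1 : 1 ≤ U := le_max_right _ _
  have hUT : T ≤ U := le_max_left _ _
  have hb : ∀ u, U ≤ u → c0 * c * Real.exp (-(Real.pi / 2) * u) / Real.sqrt u ≤ |gR u| := by
    intro u hu
    refine le_trans ?_ (hlow u (by linarith))
    have := hcon (2 * u) (by linarith)
    gcongr
  have hne : ∀ u, U ≤ u → gR u ≠ 0 := by
    intro u hu h0
    have := hb u hu
    rw [h0, abs_zero] at this
    have hu0 : 0 < u := by linarith
    have : 0 < c0 * c * Real.exp (-(Real.pi / 2) * u) / Real.sqrt u := by positivity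
    linarith
  have hcontU : ContinuousOn gR (Ici U) := gR_cont.continuousOn
  rcases lt_or_gt_of_ne (hne U le_rfl) with hs | hs
  · have hall : ∀ u, U ≤ u → gR u < 0 := by
      intro u hu
      by_contra hn
      push Not at hn
      have := intermediate_value_Icc hu (gR_cont.continuousOn (s := Icc U u)) (show (0 : ℝ) ∈ Icc (gR U) (gR u) from ⟨hs.le, hn⟩)
      obtain ⟨w, hw, hw0⟩ := this
      exact hne w hw.1 hw0
    refine gR_contra hU1 (c' := c0 * c) (by positivity) (-1) (by norm_num) fun u hu => ?_
    have := hb u hu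
    rw [abs_of_neg (hall u hu)] at this
    linarith
  · have hall : ∀ u, U ≤ u → 0 < gR u := by
      intro u hu
      by_contra hn
      push Not at hn
      have := intermediate_value_Icc' hu (gR_cont.continuousOn (s := Icc U u)) (show (0 : ℝ) ∈ Icc (gR u) (gR U) from ⟨hn, hs.le⟩)
      obtain ⟨w, hw, hw0⟩ := this
      exact hne w hw.1 hw0
    refine gR_contra hU1 (c' := c0 * c) (by positivity) 1 (by norm_num) fun u hu => ?_
    have := hb u hu
    rw [abs_of_pos (hall u hu)] at this
    linarith

lemma four_product {φ : ℂ → ℂ} {K ε : ℝ} (hφ : DifferentiableOn ℂ φ (Metric.ball 0 1))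
    (hK : ∀ z, ‖z‖ ≤ 1 / 2 → ‖φ z‖ ≤ K) (hε : ∀ z, ‖z‖ ≤ 1 / 2 → 1 / 4 ≤ z.re → ‖φ z‖ ≤ ε) :
    ‖φ 0‖ ^ 4 ≤ K ^ 3 * ε := by
  have hK0 : 0 ≤ K := (norm_nonneg _).trans (hK 0 (by simp))
  have hε0 : 0 ≤ ε := (norm_nonneg _).trans (hε ((1 / 4 : ℝ) : ℂ) (by
    rw [norm_real, Real.norm_eq_abs, abs_of_pos] <;> norm_num) (by rw [ofReal_re]))
  set H : ℂ → ℂ := fun z => φ z * φ (-z) * φ (I * z) * φ (-(I * z)) with hH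
  have hmaps : ∀ u : ℂ, ‖u‖ = 1 → DifferentiableOn ℂ (fun z => φ (u * z)) (Metric.ball 0 1) := by
    intro u hu
    refine hφ.comp (by fun_prop) ?_
    intro z hz
    simpa [hu] using hz
  have hHd : DifferentiableOn ℂ H (Metric.ball 0 1) := by
    have h1 := hmaps 1 (by simp)
    have h2 := hmaps (-1) (by simp)
    have h3 := hmaps I (by simp)
    have h4 := hmaps (-I) (by simp)
    have := ((h1.mul h2).mul h3).mul h4
    refine this.congr ?_
    intro z _
    simp [hH]
  have hdc : DiffContOnCl ℂ H (Metric.ball 0 (1 / 2)) := by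
    apply DifferentiableOn.diffContOnCl
    exact hHd.mono (Metric.closure_ball_subset_closedBall.trans
      (Metric.closedBall_subset_ball (by norm_num)))
  have hfr : ∀ z ∈ frontier (Metric.ball (0:ℂ) (1 / 2)), ‖H z‖ ≤ K ^ 3 * ε := by
    intro z hz
    rw [frontier_ball _ (by norm_num), mem_sphere_zero_iff_norm] at hz
    have n1 : ‖z‖ ≤ 1 / 2 := hz.le
    have n2 : ‖-z‖ ≤ 1 / 2 := by rw [norm_neg]; exact n1
    have n3 : ‖I * z‖ ≤ 1 / 2 := by simpa using n1
    have n4 : ‖-(I * z)‖ ≤ 1 / 2 := by simpa using n1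
    have hsq : z.re ^ 2 + z.im ^ 2 = 1 / 4 := by
      have := Complex.sq_norm z
      rw [hz, normSq_apply] at this
      linarith
    have hcases : 1 / 4 ≤ z.re ∨ 1 / 4 ≤ (-z).re ∨ 1 / 4 ≤ (I * z).re ∨ 1 / 4 ≤ (-(I * z)).re := by
      by_contra hcon
      push Not at hcon
      simp at hcon
      obtain ⟨c1, c2, c3, c4⟩ := hcon
      norm_num at c1 c2 c3 c4 hsq
      nlinarith
    simp only [hH, norm_mul]
    rcases hcases with h | h | h | h
    · calc _ ≤ ε * K * K * K := by
            gcongr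
            exacts [hε _ n1 h, hK _ n2, hK _ n3, hK _ n4]
        _ = _ := by ring
    · calc _ ≤ K * ε * K * K := by
            gcongr
            exacts [hK _ n1, hε _ n2 h, hK _ n3, hK _ n4]
        _ = _ := by ring
    · calc _ ≤ K * K * ε * K := by
            gcongr
            exacts [hK _ n1, hK _ n2, hε _ n3 h, hK _ n4]
        _ = _ := by ring
    · calc _ ≤ K * K * K * ε := by
            gcongr
            exacts [hK _ n1, hK _ n2, hK _ n3, hε _ n4 h]
        _ = _ := by ring
  have := Complex.norm_le_of_forall_mem_frontier_norm_le Metric.isBounded_ball hdc hfr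
    (subset_closure (Metric.mem_ball_self (by norm_num)))
  simp only [hH, norm_mul, mul_zero, neg_zero] at this
  calc _ = _ := by ring
    _ ≤ _ := this

lemma zeta_value {c0 c : ℝ} (hc : 0 < c) (hcc : c < c0)
    (h0 : ∀ T : ℝ, ∃ t, T ≤ t ∧ c0 ≤ ‖riemannZeta ((1 / 2 : ℝ) + t * I)‖) (T : ℝ) :
    ∃ t, T ≤ t ∧ ‖riemannZeta ((1 / 2 : ℝ) + t * I)‖ = c := by
  obtain ⟨t1, ht1, h1⟩ := zeta_small hc T
  obtain ⟨t2, ht2, h2⟩ := h0 T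
  have hcont : Continuous (fun t : ℝ => ‖riemannZeta ((1 / 2 : ℝ) + t * I)‖) := by
    rw [continuous_iff_continuousAt]
    intro t
    have hd : ContinuousAt riemannZeta ((1 / 2 : ℝ) + t * I) := by
      apply (differentiableAt_riemannZeta ?_).continuousAt
      intro h
      have := congrArg re h
      simp at this
    have h2 : ContinuousAt (fun t : ℝ => ((1 / 2 : ℝ) + t * I : ℂ)) t := by fun_prop
    exact (ContinuousAt.comp (f := fun t : ℝ => ((1 / 2 : ℝ) + t * I : ℂ)) hd h2).norm
  have := intermediate_value_uIcc (a := t1) (b := t2) hcont.continuousOn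
  obtain ⟨t, ht, htc⟩ := this (mem_uIcc.mpr (Or.inl ⟨h1.le, hcc.le.trans h2⟩))
  exact ⟨t, (le_min ht1 ht2).trans ht.1, htc⟩

theorem main_aux
    (μ : ℝ → ℝ) (hμ : Tendsto μ atTop atTop) (a b : ℂ) (hab : a ≠ b)
    (T0 : ℝ) (hom : ∀ s : ℂ, T0 ≤ s.im → |s.re - 1 / 2| < μ s.im / Real.log s.im →
      riemannZeta s ≠ a ∧ riemannZeta s ≠ b) : False := by
  obtain ⟨c0, hc0, hc0'⟩ := zeta_not_small
  obtain ⟨c, hc, hcc, hca⟩ : ∃ c : ℝ, 0 < c ∧ c < c0 ∧ c ≠ ‖a‖ := by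
    by_cases h : c0 / 2 = ‖a‖
    · exact ⟨c0 / 4, by positivity, by linarith, by rw [← h]; intro h2; linarith⟩
    · exact ⟨c0 / 2, by positivity, by linarith, h⟩
  have hba : 0 < ‖b - a‖ := norm_pos_iff.mpr (sub_ne_zero.mpr hab.symm)
  have hba0 : b - a ≠ 0 := sub_ne_zero.mpr hab.symm
  have hca' : 0 < |c - ‖a‖| := abs_pos.mpr (sub_ne_zero.mpr hca)
  set M := (c + ‖a‖) / ‖b - a‖ + ‖b - a‖ / |c - ‖a‖| with hM
  have hM0 : 0 < M := by positivity
  obtain ⟨C, hC0, hC⟩ := schottky M hM0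
  set K := ‖a‖ + ‖b - a‖ * C with hK
  have hK0 : 0 < K := by positivity
  obtain ⟨R, hR1, hR⟩ : ∃ R : ℝ, 1 ≤ R ∧ K ^ 3 * (K * Real.exp (-(R / 8))) < c ^ 4 := by
    have h1 : Tendsto (fun R : ℝ => Real.exp (-(R / 8))) atTop (𝓝 0) := by
      apply Real.tendsto_exp_neg_atTop_nhds_zero.comp
      exact tendsto_id.atTop_div_const (by norm_num)
    have h2 : Tendsto (fun R : ℝ => K ^ 3 * (K * Real.exp (-(R / 8)))) atTop (𝓝 0) := by
      simpa using (h1.const_mul K).const_mul (K ^ 3)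
    exact ((eventually_ge_atTop 1).and (h2.eventually_lt_const (by positivity))).exists
  obtain ⟨T1, hT1⟩ := eventually_atTop.mp (hμ.eventually_ge_atTop (2 * R))
  obtain ⟨τ, hτ, hτc⟩ := zeta_value hc hcc hc0' (max (max (T0 + 1) (T1 + 1)) (Real.exp (4 * R + 22)))
  have hτ0 : T0 + 1 ≤ τ := ((le_max_left _ _).trans (le_max_left _ _)).trans hτ
  have hτ1 : T1 + 1 ≤ τ := ((le_max_right _ _).trans (le_max_left _ _)).trans hτ
  have hτ2 : Real.exp (4 * R + 22) ≤ τ := (le_max_right _ _).trans hτ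
  have hτpos : 0 < τ := (Real.exp_pos _).trans_le hτ2
  have hτ4 : 4 ≤ τ := by have := Real.add_one_le_exp (4 * R + 22); linarith
  have hlog : 4 * R + 22 ≤ Real.log τ := (Real.le_log_iff_exp_le hτpos).mpr hτ2
  have hlogpos : 0 < Real.log τ := by linarith
  set r := R / Real.log τ with hr
  have hr0 : 0 < r := by positivity
  have hr4 : r ≤ 1 / 4 := by rw [hr, div_le_iff₀ hlogpos]; linarith
  set φ : ℂ → ℂ := fun z => riemannZeta ((1 / 2 : ℝ) + τ * I + r * z) with hφ
  have hpt : ∀ z : ℂ, ((1 / 2 : ℝ) + τ * I + r * z : ℂ) =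
      ((1 / 2 + r * z.re : ℝ) : ℂ) + ((τ + r * z.im : ℝ) : ℂ) * I := by
    intro z
    apply Complex.ext <;> simp
  have him : ∀ z : ℂ, ‖z‖ ≤ 1 → |r * z.im| ≤ 1 / 4 := by
    intro z hz
    rw [abs_mul, abs_of_pos hr0]
    have := (abs_im_le_norm z).trans hz
    nlinarith [abs_nonneg z.im]
  have hregion : ∀ z ∈ Metric.ball (0:ℂ) 1, φ z ≠ a ∧ φ z ≠ b := by
    intro z hz
    have hz1 : ‖z‖ < 1 := by simpa using hz
    have h1 := abs_le.mp (him z hz1.le)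
    simp only [hφ]
    rw [hpt]
    have hre : (((1 / 2 + r * z.re : ℝ) : ℂ) + ((τ + r * z.im : ℝ) : ℂ) * I).re = 1 / 2 + r * z.re := by simp
    have him' : (((1 / 2 + r * z.re : ℝ) : ℂ) + ((τ + r * z.im : ℝ) : ℂ) * I).im = τ + r * z.im := by simp
    apply hom
    · rw [him']; linarith
    · rw [hre, him', add_sub_cancel_left, abs_mul, abs_of_pos hr0]
      set t := τ + r * z.im with ht
      have hmut := hT1 t (by linarith)
      have ht2 : t ≤ τ ^ 2 := by nlinarith
      have hlt : Real.log t ≤ 2 * Real.log τ := by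
        have := Real.log_le_log (by linarith : 0 < t) ht2
        rwa [Real.log_pow] at this
      have hltpos : 0 < Real.log t := Real.log_pos (by linarith)
      have hre1 : |z.re| < 1 := (abs_re_le_norm z).trans_lt hz1
      calc r * |z.re| < r * 1 := by gcongr
        _ = R / Real.log τ := by rw [mul_one]
        _ ≤ 2 * R / Real.log t := by
          rw [div_le_div_iff₀ hlogpos hltpos]; nlinarith
        _ ≤ μ t / Real.log t := by gcongr
  have hφd : DifferentiableOn ℂ φ (Metric.ball 0 1) := by
    intro z hz
    have hz1 : ‖z‖ < 1 := by simpa using hz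
    have h1 := abs_le.mp (him z hz1.le)
    apply DifferentiableAt.differentiableWithinAt
    refine DifferentiableAt.comp (f := fun z : ℂ => ((1 / 2 : ℝ) + τ * I + r * z : ℂ)) z
      (differentiableAt_riemannZeta ?_) (by fun_prop)
    rw [hpt]
    intro h
    have := congrArg im h
    simp at this
    linarith
  have hφ0 : ‖φ 0‖ = c := by simp only [hφ, mul_zero, add_zero]; exact hτc
  have hKb : ∀ z, ‖z‖ ≤ 1 / 2 → ‖φ z‖ ≤ K := by
    intro z hz
    have := hC (fun z => (φ z - a) / (b - a)) ((hφd.sub_const a).div_const _)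
      (fun z hz => div_ne_zero (sub_ne_zero.mpr (hregion z hz).1) hba0)
      (fun z hz h => by
        rw [div_eq_one_iff_eq hba0] at h
        exact (hregion z hz).2 (by linear_combination h))
      (by
        rw [norm_div]
        have h1 : ‖φ 0 - a‖ ≤ c + ‖a‖ := (norm_sub_le _ _).trans (by rw [hφ0])
        have h2 : 0 ≤ ‖b - a‖ / |c - ‖a‖| := by positivity
        have h3 : ‖φ 0 - a‖ / ‖b - a‖ ≤ (c + ‖a‖) / ‖b - a‖ := by gcongr
        linarith)
      (by
        rw [norm_div]
        have h1 : |c - ‖a‖| ≤ ‖φ 0 - a‖ := by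
          have := abs_norm_sub_norm_le (φ 0) a
          rwa [hφ0] at this
        have h2 : 0 ≤ (c + ‖a‖) / ‖b - a‖ := by positivity
        have h3 : ‖b - a‖ / |c - ‖a‖| ≤ M := by linarith
        calc M⁻¹ ≤ (‖b - a‖ / |c - ‖a‖|)⁻¹ := by gcongr
          _ = |c - ‖a‖| / ‖b - a‖ := inv_div _ _
          _ ≤ _ := by gcongr) z hz
    rw [norm_div, div_le_iff₀ hba] at this
    have h2 : ‖φ z‖ ≤ ‖a‖ + ‖φ z - a‖ := by
      have := norm_add_le a (φ z - a); simpa using this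
    rw [hK]; linarith
  have hεb : ∀ z, ‖z‖ ≤ 1 / 2 → 1 / 4 ≤ z.re → ‖φ z‖ ≤ K * Real.exp (-(R / 8)) := by
    intro z hz hzre
    have h1 := abs_le.mp (him z (by linarith))
    set t := τ + r * z.im with ht
    have hzre1 : z.re ≤ 1 := (re_le_norm z).trans (by linarith)
    have hx0 : 0 ≤ r * z.re := by positivity
    have hrefl := zeta_reflect (x := r * z.re) (t := t) hx0
      (by nlinarith) (by linarith)
    have e1 : φ z = riemannZeta ((1 / 2 + r * z.re : ℝ) + t * I) := by
      simp only [hφ]; rw [hpt]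
    have e2 : φ (-(starRingEnd ℂ) z) = riemannZeta ((1 / 2 - r * z.re : ℝ) + t * I) := by
      simp only [hφ]; rw [hpt]; congr 1; simp [sub_eq_add_neg, ht]
    rw [← e1, ← e2] at hrefl
    have hK2 := hKb (-(starRingEnd ℂ) z) (by rwa [norm_neg, RCLike.norm_conj])
    have hlt : Real.log τ / 2 ≤ Real.log t - 10 := by
      have h3 : Real.log (τ / 2) ≤ Real.log t := Real.log_le_log (by positivity) (by linarith)
      rw [Real.log_div (by positivity) (by norm_num)] at h3
      have := Real.log_two_lt_d9
      linarith
    have hexp : Real.exp (R / 8) ≤ Real.exp (r * z.re * (Real.log t - 10)) := by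
      apply Real.exp_le_exp.mpr
      calc R / 8 = r * (1 / 4) * (Real.log τ / 2) := by rw [hr]; field_simp; norm_num
        _ ≤ _ := by gcongr
    rw [Real.exp_neg, ← div_eq_mul_inv, le_div_iff₀ (Real.exp_pos _)]
    calc ‖φ z‖ * Real.exp (R / 8) ≤ ‖φ z‖ * Real.exp (r * z.re * (Real.log t - 10)) := by gcongr
      _ ≤ K := by rw [mul_comm]; exact hrefl.trans hK2
  have := four_product hφd hKb hεb
  rw [hφ0] at this
  linarith

end Stmt6

theorem stmt6
    (μ : ℝ → ℝ) (hμpos : ∀ t : ℝ, 2 ≤ t → 0 < μ t)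
    (hμ : Tendsto μ atTop atTop) :
    ({a : ℂ | ({s : ℂ | 2 ≤ s.im ∧ |s.re - 1 / 2| < μ s.im / Real.log s.im ∧
      riemannZeta s = a}).Finite}).Subsingleton := by
  intro a ha b hb
  by_contra hab
  have hfin := Set.Finite.union ha hb
  obtain ⟨T, hT⟩ := (hfin.image Complex.im).bddAbove
  refine Stmt6.main_aux μ hμ a b hab (max 2 (T + 1)) ?_
  intro s hs hlt
  have h2 : 2 ≤ s.im := (le_max_left _ _).trans hs
  have h3 : T + 1 ≤ s.im := (le_max_right _ _).trans hs
  refine ⟨fun h => ?_, fun h => ?_⟩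
  · have := hT (mem_image_of_mem im (Or.inl ⟨h2, hlt, h⟩))
    linarith
  · have := hT (mem_image_of_mem im (Or.inr ⟨h2, hlt, h⟩))
    linarith
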